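/- Let n ≥ 1 and let S be a finite abstract simplicial complex with ‖S‖ homeomorphic to S^n. Let W be a nonempty proper subset of the vertex set of S such that the induced subcomplex S[W] (all faces of S contained in W) is nonempty and is a cone, i.e., there is a vertex v ∈ W such that σ ∪ {v} ∈ S[W] for every face σ ∈ S[W]. Then the reduced simplicial homology of S − W with ℤ/2 coefficients vanishes in every degree: H̃_i(S − W; ℤ/2) = 0 for all i ≥ 0, and S − W is nonempty and connected. -/

import Mathlib

/-- An abstract simplicial complex on vertex type `V`: a collection of nonempty finite
sets (the faces) closed under passing to nonempty subsets. -/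
def IsComplex {V : Type} [DecidableEq V] (K : Finset (Finset V)) : Prop :=
  (∀ σ ∈ K, σ.Nonempty) ∧ ∀ σ ∈ K, ∀ τ : Finset V, τ ⊆ σ → τ.Nonempty → τ ∈ K

/-- The geometric realization `‖K‖` of an abstract simplicial complex `K`. -/
def GeomRep {V : Type} [Fintype V] (K : Finset (Finset V)) : Type :=
  {x : V → ℝ // (∀ v, 0 ≤ x v) ∧ (∀ v, x v ≤ 1) ∧ (∑ v, x v) = 1 ∧
    (Finset.univ.filter fun v => x v ≠ 0) ∈ K}

instance {V : Type} [Fintype V] (K : Finset (Finset V)) : TopologicalSpace (GeomRep K) :=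
  instTopologicalSpaceSubtype

/-- The vertex set of a complex. -/
def vertexSet {V : Type} [DecidableEq V] (K : Finset (Finset V)) : Finset V :=
  K.sup id

/-- The (reduced, mod 2) boundary of a chain `θ`. -/
def chainBd {V : Type} [DecidableEq V] [Fintype V] (θ : Finset (Finset V)) :
    Finset (Finset V) :=
  Finset.univ.filter fun ρ =>
    (θ.filter fun σ => ρ ⊆ σ ∧ σ.card = ρ.card + 1).card % 2 = 1

/-- Vanishing of the reduced simplicial homology `H̃_i(C; ℤ/2)`. -/
def HVanish {V : Type} [DecidableEq V] [Fintype V] (C : Finset (Finset V)) (i : ℕ) :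
    Prop :=
  ∀ θ : Finset (Finset V), (∀ σ ∈ θ, σ ∈ C ∧ σ.card = i + 1) → chainBd θ = ∅ →
    ∃ η : Finset (Finset V), (∀ σ ∈ η, σ ∈ C ∧ σ.card = i + 2) ∧ chainBd η = θ

section

open Finsupp

/-- `ℤ/2`-chains of ordered (possibly degenerate) simplices with vertices in `X`. -/
abbrev OrdChain (X : Type*) := List X →₀ ZMod 2

/-- `ℤ/2`-chains of unordered simplices with vertices in `P`. -/
abbrev SimpChain (P : Type*) := Finset P →₀ ZMod 2

/-- The chains supported on a given set of simplices. -/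
abbrev chainsOn {α : Type*} (s : Set α) : Submodule (ZMod 2) (α →₀ ZMod 2) :=
  supported (ZMod 2) (ZMod 2) s

theorem linearCombination_mem {α M : Type*} [AddCommGroup M] [Module (ZMod 2) M]
    {s : Set α} {f : α → M} {N : Submodule (ZMod 2) M} {z : α →₀ ZMod 2}
    (hz : z ∈ chainsOn s) (h : ∀ a ∈ s, f a ∈ N) :
    linearCombination (ZMod 2) f z ∈ N := by
  rw [linearCombination_apply]
  exact Submodule.sum_mem _ fun a ha =>
    N.smul_mem _ (h a ((mem_supported _ _).1 hz ha))

theorem single_mem_chainsOn {α : Type*} {s : Set α} {a : α} (h : a ∈ s) (c : ZMod 2) :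
    single a c ∈ chainsOn s :=
  single_mem_supported _ _ h

/-- A linear map on chains sends chains on `s` into `N` if it does so for simplices. -/
theorem map_mem_of_single {α M : Type*} [AddCommGroup M] [Module (ZMod 2) M]
    {s : Set α} (f : (α →₀ ZMod 2) →ₗ[ZMod 2] M) {N : Submodule (ZMod 2) M}
    {z : α →₀ ZMod 2} (hz : z ∈ chainsOn s) (h : ∀ a ∈ s, f (single a 1) ∈ N) : f z ∈ N := by
  have : f = linearCombination (ZMod 2) fun a => f (single a 1) := by
    ext a; simp
  rw [this]
  exact linearCombination_mem hz h

theorem eq_of_single {α M : Type*} [AddCommGroup M] [Module (ZMod 2) M]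
    {s : Set α} (f g : (α →₀ ZMod 2) →ₗ[ZMod 2] M)
    {z : α →₀ ZMod 2} (hz : z ∈ chainsOn s) (h : ∀ a ∈ s, f (single a 1) = g (single a 1)) :
    f z = g z := by
  have := map_mem_of_single (f - g) (N := ⊥) hz fun a ha => by simp [h a ha]
  simpa [sub_eq_zero] using this

namespace OrdChain

variable {X Y : Type*}

/-- Adding a vertex in front of every simplex. -/
noncomputable def cone (x : X) : OrdChain X →ₗ[ZMod 2] OrdChain X :=
  lmapDomain (ZMod 2) (ZMod 2) (List.cons x)

@[simp] theorem cone_single (x : X) (l : List X) (c : ZMod 2) :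
    cone x (single l c) = single (x :: l) c := by
  simp [cone]

/-- The boundary of a single ordered simplex. -/
noncomputable def bdList : List X → OrdChain X
  | [] => 0
  | x :: l => single l 1 + cone x (bdList l)

/-- The (augmented) boundary operator on ordered chains. -/
noncomputable def bd : OrdChain X →ₗ[ZMod 2] OrdChain X :=
  linearCombination (ZMod 2) bdList

@[simp] theorem bd_single (l : List X) : bd (single l 1) = bdList l := by
  simp [bd]

theorem bd_cone (x : X) (z : OrdChain X) : bd (cone x z) = z + cone x (bd z) := by
  have : bd ∘ₗ cone x = LinearMap.id + cone x ∘ₗ bd := by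
    ext1 l; ext1; simp [bdList]
  exact LinearMap.congr_fun this z

/-- The map on ordered chains induced by a map of vertices. -/
noncomputable def map (f : X → Y) : OrdChain X →ₗ[ZMod 2] OrdChain Y :=
  lmapDomain (ZMod 2) (ZMod 2) (List.map f)

@[simp] theorem map_single (f : X → Y) (l : List X) (c : ZMod 2) :
    map f (single l c) = single (l.map f) c := by
  simp [map]

theorem map_cone (f : X → Y) (x : X) (z : OrdChain X) :
    map f (cone x z) = cone (f x) (map f z) := by
  have : map f ∘ₗ cone x = cone (f x) ∘ₗ map f := by
    ext1 l; ext1; simp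
  exact LinearMap.congr_fun this z

theorem bd_map (f : X → Y) (z : OrdChain X) : bd (map f z) = map f (bd z) := by
  have : bd ∘ₗ map f = map f ∘ₗ bd := by
    ext1 l; ext1
    simp only [LinearMap.comp_apply, lsingle_apply, bd_single, map_single]
    induction l with
    | nil => simp [bdList]
    | cons x l ih => simp [bdList, ih, map_cone]
  exact LinearMap.congr_fun this z

/-- The prism over a single ordered simplex, between two vertex maps. -/
noncomputable def prismList (f g : X → Y) : List X → OrdChain Y
  | [] => 0
  | x :: l => single (f x :: g x :: l.map g) 1 + cone (f x) (prismList f g l)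

/-- The prism operator between two vertex maps. -/
noncomputable def prism (f g : X → Y) : OrdChain X →ₗ[ZMod 2] OrdChain Y :=
  linearCombination (ZMod 2) (prismList f g)

@[simp] theorem prism_single (f g : X → Y) (l : List X) :
    prism f g (single l 1) = prismList f g l := by
  simp [prism]

theorem prism_cone (f g : X → Y) (x : X) (z : OrdChain X) :
    prism f g (cone x z) = cone (f x) (cone (g x) (map g z)) + cone (f x) (prism f g z) := by
  have : prism f g ∘ₗ cone x =
      cone (f x) ∘ₗ cone (g x) ∘ₗ map g + cone (f x) ∘ₗ prism f g := by
    ext1 l; ext1; simp [prismList]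
  exact LinearMap.congr_fun this z

theorem bd_prism (f g : X → Y) (z : OrdChain X) :
    bd (prism f g z) = map f z + map g z + prism f g (bd z) := by
  have : bd ∘ₗ prism f g = map f + map g + prism f g ∘ₗ bd := by
    ext1 l; ext1
    simp only [LinearMap.comp_apply, lsingle_apply, bd_single, map_single, prism_single,
      LinearMap.add_apply]
    induction l with
    | nil => simp [bdList, prismList, ZModModule.add_self]
    | cons x l ih =>
      have h1 : (single (f x :: g x :: l.map g) 1 : OrdChain Y) =
          cone (f x) (cone (g x) (single (l.map g) 1)) := by simp
      rw [prismList, bdList, h1]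
      simp only [map_add, bd_cone, prism_cone, ih, prism_single, ← map_single, ← bd_single, bd_map]
      simp only [map_single, cone_single, List.map_cons]
      linear_combination (norm := module)
        ZModModule.add_self (single (f x :: l.map g) 1 : OrdChain Y)
  exact LinearMap.congr_fun this z

theorem prismList_mem (f g : X → Y) (l : List X) :
    prismList f g l ∈ chainsOn
      {l' : List Y | l' ≠ [] ∧ ∀ y ∈ l', ∃ x ∈ l, y = f x ∨ y = g x} := by
  induction l with
  | nil => simp [prismList]
  | cons x l ih =>
    refine Submodule.add_mem _ (single_mem_chainsOn ?_ 1) (map_mem_of_single _ ih ?_)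
    · refine ⟨List.cons_ne_nil _ _, fun y hy => ?_⟩
      simp only [List.mem_cons, List.mem_map] at hy ⊢
      grind
    · rintro l' ⟨-, h⟩
      rw [cone_single]
      refine single_mem_chainsOn ?_ 1
      refine ⟨List.cons_ne_nil _ _, fun y hy => ?_⟩
      simp only [List.mem_cons] at hy ⊢
      grind

/-- A finite sequence of vertex maps gives a homology between the images of a cycle under the
first and the last one, through simplices spanned by the images under consecutive maps. -/
theorem exists_bd_eq_map_add_map (f : ℕ → X → Y) {z : OrdChain X} (hz : bd z = 0)
    {S : Set (List Y)} (N : ℕ)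
    (hS : ∀ l ∈ z.support, ∀ j < N, ∀ l' : List Y, l' ≠ [] →
      (∀ y ∈ l', ∃ x ∈ l, y = f j x ∨ y = f (j + 1) x) → l' ∈ S) :
    ∃ w ∈ chainsOn S, bd w = map (f 0) z + map (f N) z := by
  induction N with
  | zero => exact ⟨0, Submodule.zero_mem _, by simp [ZModModule.add_self]⟩
  | succ N ih =>
    obtain ⟨w, hw, hbd⟩ := ih fun l hl j hj => hS l hl j (by omega)
    refine ⟨w + prism (f N) (f (N + 1)) z, Submodule.add_mem _ hw ?_, ?_⟩
    · refine linearCombination_mem (s := z.support) ((mem_supported _ _).2 le_rfl) fun l hl => ?_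
      refine supported_mono ?_ (prismList_mem _ _ l)
      exact fun l' hl' => hS l hl N (by omega) l' hl'.1 hl'.2
    · rw [map_add, hbd, bd_prism, hz, map_zero]
      linear_combination (norm := module) ZModModule.add_self (map (f N) z)

end OrdChain

namespace SimpChain

variable {P : Type*} [DecidableEq P]

/-- Adding a vertex to every simplex (zero on those that already contain it). -/
noncomputable def cone (p : P) : SimpChain P →ₗ[ZMod 2] SimpChain P :=
  linearCombination (ZMod 2) fun σ => if p ∈ σ then 0 else single (insert p σ) 1

/-- The (augmented) boundary operator on simplicial chains. -/
noncomputable def bd : SimpChain P →ₗ[ZMod 2] SimpChain P :=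
  linearCombination (ZMod 2) fun σ => ∑ p ∈ σ, single (σ.erase p) 1

theorem cone_single (p : P) (σ : Finset P) :
    cone p (single σ 1) = if p ∈ σ then 0 else single (insert p σ) 1 := by
  simp [cone]

theorem bd_single (σ : Finset P) :
    bd (single σ 1) = ∑ p ∈ σ, single (σ.erase p) 1 := by
  simp [bd]

theorem bd_cone (p : P) (z : SimpChain P) : bd (cone p z) = z + cone p (bd z) := by
  have : bd ∘ₗ cone p = LinearMap.id + cone p ∘ₗ bd := by
    ext1 σ; ext1
    simp only [LinearMap.comp_apply, lsingle_apply, LinearMap.add_apply, LinearMap.id_apply,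
      cone_single, bd_single, map_sum]
    by_cases hp : p ∈ σ
    · rw [if_pos hp, map_zero, Finset.sum_eq_single_of_mem p hp]
      · simp [Finset.insert_erase hp, ZModModule.add_self]
      · intro q _ hqp
        rw [if_pos (Finset.mem_erase.2 ⟨hqp.symm, hp⟩)]
    · rw [if_neg hp, bd_single, Finset.sum_insert hp, Finset.erase_insert hp]
      congr 1
      refine Finset.sum_congr rfl fun q hq => ?_
      have hqp : p ≠ q := fun h => hp (h ▸ hq)
      rw [if_neg (fun h => hp (Finset.mem_of_mem_erase h)), Finset.erase_insert_of_ne hqp]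
  exact LinearMap.congr_fun this z

theorem bd_bd (z : SimpChain P) : bd (bd z) = 0 := by
  have : (bd ∘ₗ bd : SimpChain P →ₗ[ZMod 2] SimpChain P) = 0 := by
    ext1 σ; ext1
    simp only [LinearMap.comp_apply, lsingle_apply, LinearMap.zero_apply]
    induction σ using Finset.induction_on with
    | empty => simp [bd_single]
    | insert p σ hp ih =>
      have : (single (insert p σ) 1 : SimpChain P) = cone p (single σ 1) := by
        simp [cone_single, hp]
      rw [this, bd_cone, map_add, bd_cone, ih, map_zero, add_zero, ZModModule.add_self]
  exact LinearMap.congr_fun this z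

theorem cone_mem {p : P} {s t : Set (Finset P)} {z : SimpChain P} (hz : z ∈ chainsOn s)
    (h : ∀ σ ∈ s, p ∉ σ → insert p σ ∈ t) : cone p z ∈ chainsOn t := by
  refine linearCombination_mem hz fun σ hσ => ?_
  split_ifs with hp
  · exact Submodule.zero_mem _
  · exact single_mem_chainsOn (h σ hσ hp) 1

/-- A simplicial cone is acyclic. -/
theorem exists_bd_eq_of_cone {p : P} {s : Set (Finset P)} (h : ∀ σ ∈ s, insert p σ ∈ s)
    {z : SimpChain P} (hz : z ∈ chainsOn s) (hbd : bd z = 0) :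
    ∃ w ∈ chainsOn s, bd w = z :=
  ⟨cone p z, cone_mem hz fun σ hσ _ => h σ hσ, by simp [bd_cone, hbd]⟩

/-- The simplicial chain underlying an ordered simplex, zero if it is degenerate. -/
noncomputable def ofList : List P → SimpChain P
  | [] => single ∅ 1
  | p :: l => cone p (ofList l)

/-- The simplicial chain underlying an ordered chain. -/
noncomputable def ofOrd : OrdChain P →ₗ[ZMod 2] SimpChain P :=
  linearCombination (ZMod 2) ofList

@[simp] theorem ofOrd_single (l : List P) : ofOrd (single l 1) = ofList l := by
  simp [ofOrd]

theorem ofOrd_cone (p : P) (z : OrdChain P) : ofOrd (z.cone p) = cone p (ofOrd z) := by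
  have : ofOrd ∘ₗ OrdChain.cone p = cone p ∘ₗ ofOrd := by
    ext1 l; ext1; simp [ofList]
  exact LinearMap.congr_fun this z

theorem bd_ofOrd (z : OrdChain P) : bd (ofOrd z) = ofOrd z.bd := by
  have : bd ∘ₗ ofOrd = ofOrd ∘ₗ (OrdChain.bd (X := P)) := by
    ext1 l; ext1
    simp only [LinearMap.comp_apply, lsingle_apply, ofOrd_single, OrdChain.bd_single]
    induction l with
    | nil => simp [ofList, OrdChain.bdList, bd_single]
    | cons p l ih => simp [ofList, OrdChain.bdList, bd_cone, ih, ofOrd_cone]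
  exact LinearMap.congr_fun this z

theorem ofList_mem (l : List P) : ofList l ∈ chainsOn {l.toFinset} := by
  induction l with
  | nil => exact single_mem_chainsOn (by simp) 1
  | cons p l ih => exact cone_mem ih (by simp)

theorem ofOrd_mem {s : Set (List P)} {t : Set (Finset P)} {z : OrdChain P}
    (hz : z ∈ chainsOn s) (h : ∀ l ∈ s, l.toFinset ∈ t) : ofOrd z ∈ chainsOn t :=
  linearCombination_mem hz fun l hl =>
    supported_mono (Set.singleton_subset_iff.2 (h l hl)) (ofList_mem l)

/-- The acyclic carrier construction: if `b` is a chain map carried by the acyclic carrier `A`,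
then `b` is the boundary of a homotopy `e` carried by `A`, with prescribed value on `∅`. -/
theorem exists_carried [Fintype P] {M : Type*} [AddCommGroup M] [Module (ZMod 2) M]
    (d : M →ₗ[ZMod 2] M) (L : Set (Finset P))
    (hL : ∀ σ ∈ L, ∀ p ∈ σ, σ.erase p ∈ L) (A : Finset P → Submodule (ZMod 2) M)
    (hA : ∀ σ ∈ L, ∀ p ∈ σ, A (σ.erase p) ≤ A σ)
    (hac : ∀ σ ∈ L, σ.Nonempty → ∀ z ∈ A σ, d z = 0 → ∃ w ∈ A σ, d w = z)
    (b : SimpChain P →ₗ[ZMod 2] M)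
    (hb : ∀ σ ∈ L, d (b (single σ 1)) = b (bd (single σ 1)))
    (hbA : ∀ σ ∈ L, b (single σ 1) ∈ A σ)
    (e₀ : M) (he₀ : e₀ ∈ A ∅) (hde₀ : d e₀ = b (single ∅ 1)) :
    ∃ e : SimpChain P →ₗ[ZMod 2] M, e (single ∅ 1) = e₀ ∧
      ∀ σ ∈ L, e (single σ 1) ∈ A σ ∧
        d (e (single σ 1)) = b (single σ 1) + e (bd (single σ 1)) := by
  have key : ∀ n : ℕ, ∃ e : SimpChain P →ₗ[ZMod 2] M, e (single ∅ 1) = e₀ ∧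
      ∀ σ ∈ L, σ.card ≤ n → e (single σ 1) ∈ A σ ∧
        d (e (single σ 1)) = b (single σ 1) + e (bd (single σ 1)) := by
    intro n
    induction n with
    | zero =>
      refine ⟨linearCombination (ZMod 2) fun _ => e₀, by simp, fun σ _ hc => ?_⟩
      obtain rfl : σ = ∅ := by simpa using hc
      simp [bd_single, he₀, hde₀]
    | succ n ih =>
      obtain ⟨e, he, h⟩ := ih
      have hstep : ∀ σ : Finset P, ∃ w, σ ∈ L → σ.card = n + 1 →
          w ∈ A σ ∧ d w = b (single σ 1) + e (bd (single σ 1)) := by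
        intro σ
        by_cases hσ : σ ∈ L ∧ σ.card = n + 1
        · obtain ⟨hσ, hc⟩ := hσ
          have hc' : ∀ p ∈ σ, (σ.erase p).card ≤ n := fun p hp => by
            rw [Finset.card_erase_of_mem hp]; omega
          obtain ⟨w, hw⟩ := hac σ hσ (Finset.card_pos.1 (by omega))
            (b (single σ 1) + e (bd (single σ 1)))
            (by
              refine Submodule.add_mem _ (hbA σ hσ) ?_
              rw [bd_single, map_sum]
              exact Submodule.sum_mem _ fun p hp =>
                hA σ hσ p hp (h _ (hL σ hσ p hp) (hc' p hp)).1)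
            (by
              have h1 : d (e (bd (single σ 1))) =
                  b (bd (single σ 1)) + e (bd (bd (single σ 1))) := by
                rw [bd_single]
                simp only [map_sum]
                rw [← Finset.sum_add_distrib]
                exact Finset.sum_congr rfl fun p hp => (h _ (hL σ hσ p hp) (hc' p hp)).2
              rw [map_add, hb σ hσ, h1, bd_bd, map_zero, add_zero, ZModModule.add_self])
          exact ⟨w, fun _ _ => hw⟩
        · exact ⟨0, fun h1 h2 => absurd ⟨h1, h2⟩ hσ⟩
      choose w hw using hstep
      let e' : SimpChain P →ₗ[ZMod 2] M := linearCombination (ZMod 2) fun σ =>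
        if σ.card = n + 1 then w σ else e (single σ 1)
      have he' : ∀ σ : Finset P, σ.card ≤ n → e' (single σ 1) = e (single σ 1) := by
        intro σ hc
        simp [e', show σ.card ≠ n + 1 by omega]
      have hbd' : ∀ σ : Finset P, σ.card ≤ n + 1 → e' (bd (single σ 1)) = e (bd (single σ 1)) := by
        intro σ hc
        rw [bd_single, map_sum, map_sum]
        exact Finset.sum_congr rfl fun p hp => he' _ (by
          rw [Finset.card_erase_of_mem hp]; omega)
      refine ⟨e', by rw [he' ∅ (by simp), he], fun σ hσ hc => ?_⟩
      rw [hbd' σ hc]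
      rcases Nat.lt_or_ge n σ.card with hlt | hle
      · have : e' (single σ 1) = w σ := by simp [e', show σ.card = n + 1 by omega]
        rw [this]
        exact hw σ hσ (by omega)
      · rw [he' σ hle]
        exact h σ hσ hle
  obtain ⟨e, he, h⟩ := key (Fintype.card P)
  exact ⟨e, he, fun σ hσ => h σ hσ (Finset.card_le_univ σ)⟩

end SimpChain

/-- The ordered simplices with vertices in `C` all of whose edges are shorter than `ε`. -/
def smallLists {E : Type*} [PseudoMetricSpace E] (C : Set E) (ε : ℝ) : Set (List E) :=
  {l | (∀ x ∈ l, x ∈ C) ∧ ∀ x ∈ l, ∀ y ∈ l, dist x y < ε}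

theorem smallLists_mono {E : Type*} [PseudoMetricSpace E] {C C' : Set E} {ε : ℝ} (h : C ⊆ C') :
    smallLists C ε ⊆ smallLists C' ε :=
  fun _ hl => ⟨fun x hx => h (hl.1 x hx), hl.2⟩

/-- The complex of small simplices in a convex set is acyclic. -/
theorem Convex.exists_bd_eq {E : Type*} [SeminormedAddCommGroup E] [NormedSpace ℝ E]
    {C : Set E} (hC : Convex ℝ C) {c : E} (hc : c ∈ C) {ε : ℝ} (hε : 0 < ε) {z : OrdChain E}
    (hz : z ∈ chainsOn (smallLists C ε)) (hbd : OrdChain.bd z = 0) :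
    ∃ w ∈ chainsOn (smallLists C ε), OrdChain.bd w = z := by
  have hz' : ∀ l ∈ z.support, l ∈ smallLists C ε := fun l hl => (mem_supported _ _).1 hz hl
  have hN : ∀ᶠ N : ℕ in Filter.atTop, ∀ l ∈ z.support, ∀ x ∈ l, ∀ y ∈ l,
      dist x y + 1 / (N : ℝ) * dist y c < ε := by
    rw [Filter.eventually_all_finset]
    intro l hl
    refine (Filter.eventually_all_finite l.finite_toSet).2 fun x hx => ?_
    refine (Filter.eventually_all_finite l.finite_toSet).2 fun y hy => ?_
    have h1 : Filter.Tendsto (fun N : ℕ => dist x y + 1 / (N : ℝ) * dist y c) Filter.atTop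
        (nhds (dist x y + 0 * dist y c)) :=
      (tendsto_one_div_atTop_nhds_zero_nat.mul_const _).const_add _
    refine h1.eventually_lt_const ?_
    simpa using (hz' l hl).2 x hx y hy
  obtain ⟨N, hN, hN0⟩ := (hN.and (Filter.eventually_gt_atTop 0)).exists
  have hNpos : (0 : ℝ) < N := by exact_mod_cast hN0
  let f : ℕ → E → E := fun j x => AffineMap.lineMap x c ((j : ℝ) / N)
  have hf_mem : ∀ j ≤ N, ∀ x ∈ C, f j x ∈ C := fun j hj x hx =>
    hC.lineMap_mem hx hc ⟨by positivity, div_le_one_of_le₀ (by exact_mod_cast hj) hNpos.le⟩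
  have hf_dist : ∀ j ≤ N, ∀ x y, dist (f j x) (f j y) ≤ dist x y := by
    intro j hj x y
    have ht0 : (0 : ℝ) ≤ (j : ℝ) / N := by positivity
    have ht1 : (j : ℝ) / N ≤ 1 := div_le_one_of_le₀ (by exact_mod_cast hj) hNpos.le
    simp only [f, AffineMap.lineMap_apply_module, dist_add_right]
    rw [dist_smul₀, Real.norm_of_nonneg (by linarith)]
    exact mul_le_of_le_one_left dist_nonneg (by linarith)
  have hf_step : ∀ j, ∀ y, dist (f j y) (f (j + 1) y) = 1 / (N : ℝ) * dist y c := by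
    intro j y
    simp only [f]
    rw [dist_lineMap_lineMap, dist_comm, Real.dist_eq]
    push_cast
    rw [show ((j : ℝ) + 1) / N - j / N = 1 / N by ring, abs_of_pos (by positivity)]
  obtain ⟨w, hw, hwbd⟩ := OrdChain.exists_bd_eq_map_add_map f hbd
    (S := smallLists C ε) N (by
      intro l hl j hj l' _ h'
      have hfar : ∀ x ∈ l, ∀ y ∈ l, dist (f j x) (f (j + 1) y) < ε := fun x hx y hy =>
        calc dist (f j x) (f (j + 1) y) ≤ dist (f j x) (f j y) + dist (f j y) (f (j + 1) y) :=
              dist_triangle _ _ _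
          _ ≤ dist x y + 1 / (N : ℝ) * dist y c :=
              add_le_add (hf_dist j hj.le x y) (hf_step j y).le
          _ < ε := hN l hl x hx y hy
      have hnear : ∀ i ≤ N, ∀ x ∈ l, ∀ y ∈ l, dist (f i x) (f i y) < ε := fun i hi x hx y hy =>
        (hf_dist i hi x y).trans_lt ((hz' l hl).2 x hx y hy)
      refine ⟨fun y hy => ?_, fun a ha b hb => ?_⟩
      · obtain ⟨x, hx, rfl | rfl⟩ := h' y hy
        · exact hf_mem j hj.le x ((hz' l hl).1 x hx)
        · exact hf_mem (j + 1) hj x ((hz' l hl).1 x hx)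
      · obtain ⟨x, hx, rfl | rfl⟩ := h' a ha <;> obtain ⟨y, hy, rfl | rfl⟩ := h' b hb
        · exact hnear j hj.le x hx y hy
        · exact hfar x hx y hy
        · rw [dist_comm]; exact hfar y hy x hx
        · exact hnear (j + 1) hj x hx y hy)
  have h0 : OrdChain.map (f 0) z = z := by
    have : f 0 = id := by ext x; simp [f]
    simp [OrdChain.map, this]
  have hlast : OrdChain.map (f N) z ∈ chainsOn {l : List E | ∀ x ∈ l, x = c} := by
    refine map_mem_of_single _ hz fun l _ => ?_
    rw [OrdChain.map_single]
    refine single_mem_chainsOn ?_ 1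
    intro y hy
    obtain ⟨x, _, rfl⟩ := List.mem_map.1 hy
    simp [f, hNpos.ne']
  refine ⟨w + OrdChain.cone c (OrdChain.map (f N) z), Submodule.add_mem _ hw ?_, ?_⟩
  · refine map_mem_of_single _ hlast fun l hl => ?_
    rw [OrdChain.cone_single]
    refine single_mem_chainsOn ?_ 1
    have hl' : ∀ x ∈ c :: l, x = c := by simpa using hl
    refine ⟨fun x hx => hl' x hx ▸ hc, fun x hx y hy => ?_⟩
    rw [hl' x hx, hl' y hy, dist_self]
    exact hε
  · rw [map_add, hwbd, OrdChain.bd_cone, OrdChain.bd_map, hbd, h0, map_zero, map_zero]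
    linear_combination (norm := module) ZModModule.add_self (OrdChain.map (f N) z)

/-- The set of coordinates at which a function does not vanish. -/
noncomputable def coordSupport {P : Type*} [Fintype P] (x : P → ℝ) : Finset P :=
  Finset.univ.filter fun p => x p ≠ 0

@[simp] theorem mem_coordSupport {P : Type*} [Fintype P] {x : P → ℝ} {p : P} :
    p ∈ coordSupport x ↔ x p ≠ 0 := by
  simp [coordSupport]

/-- The geometric realization of a family of simplices, as a set of functions. -/
def realization {P : Type*} [Fintype P] (L : Set (Finset P)) : Set (P → ℝ) :=
  {x | (∀ p, 0 ≤ x p) ∧ ∑ p, x p = 1 ∧ coordSupport x ∈ L}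

section Realization

variable {P : Type*} [Fintype P]

theorem realization_mono {L L' : Set (Finset P)} (h : L ⊆ L') : realization L ⊆ realization L' :=
  fun _ hx => ⟨hx.1, hx.2.1, h hx.2.2⟩

theorem convex_realization_subset (σ : Finset P) : Convex ℝ (realization {τ | τ ⊆ σ}) := by
  intro x hx y hy a b ha hb hab
  refine ⟨fun p => ?_, ?_, fun p hp => ?_⟩
  · have := hx.1 p
    have := hy.1 p
    simp only [Pi.add_apply, Pi.smul_apply, smul_eq_mul]
    positivity
  · simp [Finset.sum_add_distrib, ← Finset.mul_sum, hx.2.1, hy.2.1, hab]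
  · by_contra h
    have hx0 : x p = 0 := by
      by_contra h0
      exact h (hx.2.2 (mem_coordSupport.2 h0))
    have hy0 : y p = 0 := by
      by_contra h0
      exact h (hy.2.2 (mem_coordSupport.2 h0))
    exact mem_coordSupport.1 hp (by simp [hx0, hy0])

theorem single_mem_realization [DecidableEq P] {L : Set (Finset P)} {p : P} (hp : {p} ∈ L) :
    (Pi.single p 1 : P → ℝ) ∈ realization L := by
  refine ⟨fun q => ?_, by simp, ?_⟩
  · by_cases h : q = p
    · subst h; simp
    · simp [h]
  · convert hp
    ext q
    simp [Pi.single_apply]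

theorem isCompact_realization {L : Set (Finset P)} (hL : ∀ σ ∈ L, ∀ τ ⊆ σ, τ ∈ L) :
    IsCompact (realization L) := by
  have heq : realization L = Set.Icc 0 1 ∩ {x | ∑ p, x p = 1} ∩
      ⋃ σ ∈ L, ⋂ p ∈ {p | p ∉ σ}, {x : P → ℝ | x p = 0} := by
    ext x
    simp only [Set.mem_inter_iff, Set.mem_iUnion, Set.mem_iInter, Set.mem_ofPred_eq]
    constructor
    · rintro ⟨h0, h1, hx⟩
      refine ⟨⟨⟨h0, fun p => ?_⟩, h1⟩, _, hx, fun p hp => by simpa using hp⟩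
      rw [Pi.one_apply, ← h1]
      exact Finset.single_le_sum (fun q _ => h0 q) (Finset.mem_univ p)
    · rintro ⟨⟨h0, h1⟩, σ, hσ, hx⟩
      refine ⟨h0.1, h1, hL σ hσ _ fun p hp => ?_⟩
      by_contra h
      exact mem_coordSupport.1 hp (hx p h)
  rw [heq]
  refine (isCompact_Icc.inter_right (isClosed_eq (by fun_prop) continuous_const)).inter_right ?_
  refine L.toFinite.isClosed_biUnion fun σ _ => isClosed_biInter fun p _ => ?_
  exact isClosed_eq (continuous_apply p) continuous_const

/-- A complex is acyclic if its realization can be contracted by a homotopy starting with a map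
carried by an acyclic carrier `Φ`. -/
theorem exists_bd_eq_of_contraction [DecidableEq P] {L : Set (Finset P)}
    (hL : ∀ σ ∈ L, ∀ τ ⊆ σ, τ ∈ L) (Φ : Finset P → Set (Finset P)) (hΦL : ∀ σ, Φ σ ⊆ L)
    (hΦ : ∀ σ τ, τ ⊆ σ → Φ τ ⊆ Φ σ) (hself : ∀ σ ∈ L, σ ∈ Φ σ)
    (hdown : ∀ σ, ∀ τ ∈ Φ σ, ∀ τ' ⊆ τ, τ' ∈ Φ σ)
    (hcone : ∀ σ ∈ L, σ.Nonempty → ∃ p, ∀ τ ∈ Φ σ, insert p τ ∈ Φ σ)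
    {G : (P → ℝ) × ℝ → P → ℝ} (hG : ContinuousOn G (realization L ×ˢ Set.Icc 0 1))
    (hmaps : Set.MapsTo G (realization L ×ˢ Set.Icc 0 1) (realization L))
    (h0 : ∀ x ∈ realization L, coordSupport (G (x, 0)) ∈ Φ (coordSupport x))
    {y₀ : P → ℝ} (hy₀ : y₀ ∈ realization L) (h1 : ∀ x ∈ realization L, G (x, 1) = y₀)
    {z : SimpChain P} (hz : z ∈ chainsOn L) (hbd : SimpChain.bd z = 0) :
    ∃ w ∈ chainsOn L, SimpChain.bd w = z := by
  have hP : Nonempty P := by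
    by_contra h
    rw [not_nonempty_iff] at h
    simpa using hy₀.2.1
  have hcard : (0 : ℝ) < Fintype.card P := by exact_mod_cast Fintype.card_pos
  set δ : ℝ := 1 / Fintype.card P with hδ
  have hδpos : 0 < δ := by positivity
  have hφ : ∀ y : P → ℝ, ∃ p, y ∈ realization L → δ ≤ y p := by
    intro y
    by_contra! h
    have hlt : ∑ p, y p < ∑ _p : P, δ :=
      Finset.sum_lt_sum_of_nonempty Finset.univ_nonempty fun p _ => (h p).2
    rw [(h hP.some).1.2.1] at hlt
    simp [hδ, hcard.ne'] at hlt
  choose φ hφ using hφ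
  have hsupp : ∀ y ∈ realization L, ∀ y' : P → ℝ, dist y y' < δ → φ y ∈ coordSupport y' := by
    intro y hy y' hd
    rw [mem_coordSupport]
    have h2 := hφ y hy
    have h3 := (dist_le_pi_dist y y' (φ y)).trans_lt hd
    intro h
    rw [h, Real.dist_eq, sub_zero] at h3
    linarith [le_abs_self (y (φ y))]
  have hunif := (isCompact_realization hL).prod (isCompact_Icc (a := (0 : ℝ)) (b := 1))
    |>.uniformContinuousOn_of_continuous hG
  obtain ⟨ε, hε, hunif⟩ := Metric.uniformContinuousOn_iff.1 hunif δ hδpos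
  obtain ⟨n, hn⟩ := exists_nat_one_div_lt hε
  set N := n + 1 with hN
  have hNε : 1 / (N : ℝ) < ε := by rw [hN]; exact_mod_cast hn
  have hNpos : (0 : ℝ) < N := by rw [hN]; positivity
  have hcell : ∀ σ ∈ L, realization {τ | τ ⊆ σ} ⊆ realization L := fun σ hσ =>
    realization_mono fun τ hτ => hL σ hσ τ hτ
  have herase : ∀ σ ∈ L, ∀ p ∈ σ, σ.erase p ∈ L := fun σ hσ p _ =>
    hL σ hσ _ (Finset.erase_subset _ _)
  -- subdivision of the complex into small simplices
  obtain ⟨c, hc0, hc⟩ := SimpChain.exists_carried OrdChain.bd L herase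
    (fun σ => chainsOn (smallLists (realization {τ | τ ⊆ σ}) ε))
    (fun σ _ p _ => supported_mono <| smallLists_mono <|
      realization_mono fun τ hτ => hτ.trans (Finset.erase_subset p σ))
    (fun σ _ ⟨p, hp⟩ z hz hbd => (convex_realization_subset σ).exists_bd_eq
      (single_mem_realization (p := p) (Finset.singleton_subset_iff.2 hp)) hε hz hbd)
    0 (by simp) (by simp) (single [] 1) (single_mem_chainsOn (by simp [smallLists]) 1)
    (by simp [OrdChain.bdList])
  simp only [LinearMap.zero_apply, zero_add] at hc
  let F : ℕ → (P → ℝ) → P := fun j x => φ (G (x, (j : ℝ) / N))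
  have htime : ∀ j ≤ N, (j : ℝ) / N ∈ Set.Icc (0 : ℝ) 1 := fun j hj =>
    ⟨by positivity, div_le_one_of_le₀ (by exact_mod_cast hj) hNpos.le⟩
  -- comparison of the subdivision with the identity
  obtain ⟨e, he0, he⟩ := SimpChain.exists_carried SimpChain.bd L herase
    (fun σ => chainsOn (Φ σ))
    (fun σ _ p _ => supported_mono (hΦ _ _ (Finset.erase_subset p σ)))
    (fun σ hσ hne z hz hbd => by
      obtain ⟨p, hp⟩ := hcone σ hσ hne
      exact SimpChain.exists_bd_eq_of_cone hp hz hbd)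
    (SimpChain.ofOrd ∘ₗ OrdChain.map (F 0) ∘ₗ c + LinearMap.id)
    (fun σ hσ => by
      simp only [LinearMap.add_apply, LinearMap.comp_apply, LinearMap.id_apply, map_add,
        SimpChain.bd_ofOrd, OrdChain.bd_map, (hc σ hσ).2])
    (fun σ hσ => by
      refine Submodule.add_mem _ ?_ (single_mem_chainsOn (hself σ hσ) 1)
      refine SimpChain.ofOrd_mem (s := {l | l.toFinset ∈ Φ σ}) ?_ fun l hl => hl
      refine map_mem_of_single (OrdChain.map (F 0)) (hc σ hσ).1 fun l hl => ?_
      rw [OrdChain.map_single]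
      refine single_mem_chainsOn ?_ 1
      rcases l with - | ⟨x₀, l⟩
      · exact hdown σ σ (hself σ hσ) _ (by simp)
      · have hx₀ := hl.1 x₀ (by simp)
        have hmem := h0 x₀ (hcell σ hσ hx₀)
        refine hdown σ _ (hΦ _ _ hx₀.2.2 hmem) _ fun q hq => ?_
        obtain ⟨x, hx, rfl⟩ := List.mem_map.1 (List.mem_toFinset.1 hq)
        have hxL := hcell σ hσ (hl.1 x hx)
        have ht : (0 : ℝ) ∈ Set.Icc (0 : ℝ) 1 := by simp
        simp only [F, Nat.cast_zero, zero_div]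
        refine hsupp _ (hmaps ⟨hxL, ht⟩) _ (hunif _ ⟨hxL, ht⟩ _ ⟨hcell σ hσ hx₀, ht⟩ ?_)
        simpa [Prod.dist_eq, hε] using hl.2 x hx x₀ (by simp))
    0 (Submodule.zero_mem _) (by
      simp [hc0, SimpChain.ofList, ZModModule.add_self])
  have hcz : OrdChain.bd (c z) = 0 := by
    have := eq_of_single (OrdChain.bd ∘ₗ c) (c ∘ₗ SimpChain.bd) hz fun σ hσ => (hc σ hσ).2
    simpa [hbd] using this
  have hcz_mem : c z ∈ chainsOn (smallLists (realization L) ε) :=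
    map_mem_of_single c hz fun σ hσ => supported_mono
      (smallLists_mono (hcell σ hσ)) (hc σ hσ).1
  obtain ⟨w, hw, hwbd⟩ := OrdChain.exists_bd_eq_map_add_map F hcz
    (S := {l | l.toFinset ∈ L}) N (by
      intro l hl j hj l' hne h'
      have hl' := (mem_supported _ _).1 hcz_mem hl
      have hstep : |((j : ℝ) + 1) / N - j / N| < ε := by
        rw [show ((j : ℝ) + 1) / N - j / N = 1 / N by ring, abs_of_pos (by positivity)]
        exact hNε
      have hcl : ∀ q ∈ l', ∃ x ∈ l, ∃ t ∈ Set.Icc (0 : ℝ) 1, q = φ (G (x, t)) ∧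
          (t = j / N ∨ t = (j + 1) / N) := by
        intro q hq
        obtain ⟨x, hx, h | h⟩ := h' q hq
        · exact ⟨x, hx, _, htime j hj.le, h, Or.inl rfl⟩
        · exact ⟨x, hx, _, htime (j + 1) hj, h, Or.inr (by push_cast; rfl)⟩
      obtain ⟨q₀, hq₀⟩ := List.exists_mem_of_ne_nil l' hne
      obtain ⟨x₀, hx₀, t₀, ht₀, -, ht₀'⟩ := hcl q₀ hq₀
      have hx₀L := hl'.1 x₀ hx₀
      refine hL _ (hmaps (show (x₀, t₀) ∈ _ from ⟨hx₀L, ht₀⟩)).2.2 _ fun q hq => ?_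
      obtain ⟨x, hx, t, ht, rfl, ht'⟩ := hcl q (List.mem_toFinset.1 hq)
      have hxL := hl'.1 x hx
      refine hsupp _ (hmaps ⟨hxL, ht⟩) _ (hunif _ ⟨hxL, ht⟩ _ ⟨hx₀L, ht₀⟩ ?_)
      rw [Prod.dist_eq]
      refine max_lt (hl'.2 x hx x₀ hx₀) ?_
      rw [Real.dist_eq]
      rcases ht' with rfl | rfl <;> rcases ht₀' with rfl | rfl
      · simpa using hε
      · rw [abs_sub_comm]; exact hstep
      · exact hstep
      · simpa using hε)
  have hlast : SimpChain.ofOrd (OrdChain.map (F N) (c z)) ∈ chainsOn {τ | τ ⊆ {φ y₀}} := by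
    refine SimpChain.ofOrd_mem (s := {l | ∀ q ∈ l, q = φ y₀}) ?_ fun l hl q hq => by
      simpa using hl q (List.mem_toFinset.1 hq)
    refine map_mem_of_single _ hcz_mem fun l hl => ?_
    rw [OrdChain.map_single]
    refine single_mem_chainsOn ?_ 1
    intro q hq
    obtain ⟨x, hx, rfl⟩ := List.mem_map.1 hq
    simp only [F, div_self hNpos.ne', h1 x (hl.1 x hx)]
  obtain ⟨w', hw', hwbd'⟩ := SimpChain.exists_bd_eq_of_cone (p := φ y₀)
    (fun τ hτ => by
      refine Finset.insert_subset (Finset.mem_singleton_self _) hτ) hlast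
    (by rw [SimpChain.bd_ofOrd, OrdChain.bd_map, hcz, map_zero, map_zero])
  refine ⟨e z + SimpChain.ofOrd w + w', Submodule.add_mem _ (Submodule.add_mem _ ?_ ?_) ?_, ?_⟩
  · exact map_mem_of_single e hz fun σ hσ => supported_mono (hΦL σ) (he σ hσ).1
  · exact SimpChain.ofOrd_mem hw fun l hl => hl
  · refine supported_mono (fun τ hτ => hL _ hy₀.2.2 _ (hτ.trans ?_)) hw'
    rw [Finset.singleton_subset_iff]
    exact hsupp y₀ hy₀ y₀ (by simpa using hδpos)
  · have hez := eq_of_single (SimpChain.bd ∘ₗ e)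
      ((SimpChain.ofOrd ∘ₗ OrdChain.map (F 0) ∘ₗ c + LinearMap.id) + e ∘ₗ SimpChain.bd) hz
      fun σ hσ => (he σ hσ).2
    simp only [LinearMap.comp_apply, LinearMap.add_apply, LinearMap.id_apply, hbd, map_zero,
      add_zero] at hez
    rw [map_add, map_add, hez, SimpChain.bd_ofOrd, hwbd, hwbd', map_add]
    linear_combination (norm := module)
      ZModModule.add_self (SimpChain.ofOrd (OrdChain.map (F 0) (c z))) +
      ZModModule.add_self (SimpChain.ofOrd (OrdChain.map (F N) (c z)))

end Realization

namespace SimpChain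

/-- The join of a complex on `V` with the boundary of the simplex on `T`. -/
def joinBoundary {V : Type*} (T : Type*) [Fintype T] (K : Set (Finset V)) :
    Set (Finset (V ⊕ T)) :=
  {σ | σ.toLeft ∈ K ∧ σ.toRight ≠ Finset.univ}

variable {V T : Type*} [DecidableEq V] [DecidableEq T]

theorem erase_disjSum_inl (A : Finset V) (B : Finset T) (a : V) :
    (A.disjSum B).erase (Sum.inl a) = (A.erase a).disjSum B := by
  ext (x | x) <;> simp

theorem erase_disjSum_inr (A : Finset V) (B : Finset T) (b : T) :
    (A.disjSum B).erase (Sum.inr b) = A.disjSum (B.erase b) := by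
  ext (x | x) <;> simp

theorem bd_single_disjSum (A : Finset V) (B : Finset T) :
    bd (single (A.disjSum B) 1) = ∑ a ∈ A, single ((A.erase a).disjSum B) 1 +
      ∑ b ∈ B, single (A.disjSum (B.erase b)) 1 := by
  rw [bd_single, Finset.sum_disjSum]
  simp only [erase_disjSum_inl, erase_disjSum_inr]

variable [Fintype T]

/-- The join of a simplicial chain with the simplex on `T`. -/
noncomputable def joinSimplex : SimpChain V →ₗ[ZMod 2] SimpChain (V ⊕ T) :=
  linearCombination (ZMod 2) fun κ => single (κ.disjSum Finset.univ) 1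

/-- The join of a simplicial chain with the boundary of the simplex on `T`. -/
noncomputable def joinSimplexBoundary : SimpChain V →ₗ[ZMod 2] SimpChain (V ⊕ T) :=
  linearCombination (ZMod 2) fun κ => ∑ t, single (κ.disjSum (Finset.univ.erase t)) 1

/-- The part of a chain consisting of simplices that contain all of `T`. -/
noncomputable def residue : SimpChain (V ⊕ T) →ₗ[ZMod 2] SimpChain V :=
  linearCombination (ZMod 2) fun σ => if σ.toRight = Finset.univ then single σ.toLeft 1 else 0

theorem residue_single_disjSum {V T : Type*} [Fintype T] [DecidableEq T] (A : Finset V)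
    (B : Finset T) :
    residue (single (A.disjSum B) 1) = if B = Finset.univ then single A 1 else 0 := by
  simp [residue]

theorem bd_joinSimplex (z : SimpChain V) :
    bd (joinSimplex (T := T) z) = joinSimplex (bd z) + joinSimplexBoundary z := by
  have : bd ∘ₗ joinSimplex (T := T) =
      joinSimplex (V := V) ∘ₗ bd + joinSimplexBoundary := by
    ext1 κ; ext1
    simp [joinSimplex, joinSimplexBoundary, bd_single, erase_disjSum_inl, erase_disjSum_inr]
  exact LinearMap.congr_fun this z

theorem residue_joinSimplex {V T : Type*} [Fintype T] [DecidableEq T] (z : SimpChain V) :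
    residue (joinSimplex (T := T) z) = z := by
  have : residue ∘ₗ joinSimplex (T := T) = (LinearMap.id : SimpChain V →ₗ[ZMod 2] _) := by
    ext1 κ; ext1
    simp [joinSimplex, residue_single_disjSum]
  exact LinearMap.congr_fun this z

theorem bd_residue (z : SimpChain (V ⊕ T)) : bd (residue z) = residue (bd z) := by
  have : bd ∘ₗ residue (V := V) (T := T) = residue ∘ₗ bd := by
    ext1 σ; ext1
    rw [← Finset.toLeft_disjSum_toRight (u := σ)]
    generalize σ.toLeft = A
    generalize σ.toRight = B
    have hB : ∀ b ∈ B, B.erase b ≠ Finset.univ := fun b _ h =>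
      Finset.notMem_erase b B (h ▸ Finset.mem_univ b)
    simp only [LinearMap.comp_apply, lsingle_apply, bd_single_disjSum, map_add, map_sum,
      residue_single_disjSum]
    rw [Finset.sum_congr rfl fun b hb => if_neg (hB b hb)]
    split_ifs <;> simp [bd_single]
  exact LinearMap.congr_fun this z

/-- If the join of `K` with the boundary of a simplex is acyclic, then so is `K`. -/
theorem exists_bd_eq_of_joinBoundary [Nonempty T] {K : Set (Finset V)}
    (h : ∀ z ∈ chainsOn (joinBoundary T K), bd z = 0 →
      ∃ w ∈ chainsOn (joinBoundary T K), bd w = z)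
    {z : SimpChain V} (hz : z ∈ chainsOn K) (hbd : bd z = 0) :
    ∃ w ∈ chainsOn K, bd w = z := by
  obtain ⟨t⟩ := ‹Nonempty T›
  obtain ⟨η, hη, hηbd⟩ := h (bd (joinSimplex z))
    (by
      rw [bd_joinSimplex, hbd, map_zero, zero_add]
      refine linearCombination_mem hz fun κ hκ => Submodule.sum_mem _ fun t _ =>
        single_mem_chainsOn ?_ 1
      refine ⟨by simpa using hκ, fun h => ?_⟩
      rw [Finset.toRight_disjSum] at h
      have ht := Finset.mem_univ t
      rw [← h] at ht
      exact Finset.notMem_erase _ _ ht)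
    (bd_bd _)
  have hy : joinSimplex z + η ∈ chainsOn {σ : Finset (V ⊕ T) | σ.toLeft ∈ K} := by
    refine Submodule.add_mem _ (linearCombination_mem hz fun κ hκ => single_mem_chainsOn ?_ 1)
      (supported_mono (fun σ hσ => hσ.1) hη)
    change (κ.disjSum Finset.univ).toLeft ∈ K
    simpa using hκ
  have hres : residue η = 0 := by
    have := linearCombination_mem (N := ⊥) (f := fun σ : Finset (V ⊕ T) =>
      if σ.toRight = Finset.univ then (single σ.toLeft 1 : SimpChain V) else 0) hη
      fun σ hσ => by simp [hσ.2]
    simpa [residue] using this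
  refine ⟨residue (cone (Sum.inr t) (joinSimplex z + η)), ?_, ?_⟩
  · refine linearCombination_mem (s := {σ : Finset (V ⊕ T) | σ.toLeft ∈ K})
      (cone_mem hy fun σ hσ _ => ?_) fun σ hσ => ?_
    · change (insert (Sum.inr t) σ).toLeft ∈ K
      simpa using hσ
    · split_ifs
      · exact single_mem_chainsOn (s := K) (a := σ.toLeft) hσ 1
      · exact Submodule.zero_mem _
  · rw [bd_residue, bd_cone, map_add bd, hηbd, ZModModule.add_self, map_zero, add_zero, map_add,
      residue_joinSimplex, hres, add_zero]

theorem bd_apply {V : Type*} [DecidableEq V] [Fintype V] (z : SimpChain V) (ρ : Finset V) :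
    bd z ρ = ∑ σ with ρ ⊆ σ ∧ σ.card = ρ.card + 1, z σ := by
  have : lapply ρ ∘ₗ bd =
      ∑ σ : Finset V with ρ ⊆ σ ∧ σ.card = ρ.card + 1, lapply (R := ZMod 2) σ := by
    ext1 τ; ext1
    simp only [LinearMap.comp_apply, lsingle_apply, bd_single, map_sum, lapply_apply,
      LinearMap.sum_apply, single_apply]
    rw [Finset.sum_ite_eq]
    simp only [Finset.mem_filter, Finset.mem_univ, true_and]
    split_ifs with h
    · obtain ⟨hρ, hc⟩ := h
      obtain ⟨p, hp⟩ := Finset.card_eq_one.1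
        (show (τ \ ρ).card = 1 by rw [Finset.card_sdiff_of_subset hρ]; omega)
      have hpτ : p ∈ τ ∧ p ∉ ρ := Finset.mem_sdiff.1 (hp ▸ Finset.mem_singleton_self p)
      have herase : ∀ q ∈ τ, τ.erase q = ρ ↔ q = p := by
        intro q hq
        constructor
        · rintro rfl
          by_contra hne
          exact hpτ.2 (Finset.mem_erase.2 ⟨fun h => hne h.symm, hpτ.1⟩)
        · rintro rfl
          rw [Finset.erase_eq, ← hp, Finset.sdiff_sdiff_eq_self hρ]
      rw [Finset.sum_congr rfl fun q hq => if_congr (herase q hq) rfl rfl]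
      simp [hpτ.1]
    · refine Finset.sum_eq_zero fun q hq => if_neg ?_
      rintro rfl
      exact h ⟨Finset.erase_subset _ _, (Finset.card_erase_add_one hq).symm⟩
  simpa using LinearMap.congr_fun this z

end SimpChain

/-- The chain given by a set of simplices. -/
noncomputable def chainOf {V : Type} [DecidableEq V] [Fintype V] (θ : Finset (Finset V)) :
    SimpChain V :=
  equivFunOnFinite.symm fun σ => if σ ∈ θ then 1 else 0

theorem mem_chainBd {V : Type} [DecidableEq V] [Fintype V] {θ : Finset (Finset V)}
    {ρ : Finset V} : ρ ∈ chainBd θ ↔ SimpChain.bd (chainOf θ) ρ = 1 := by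
  have h : SimpChain.bd (chainOf θ) ρ =
      ((θ.filter fun σ => ρ ⊆ σ ∧ σ.card = ρ.card + 1).card : ZMod 2) := by
    rw [SimpChain.bd_apply]
    simp only [chainOf, equivFunOnFinite_symm_apply_apply]
    rw [Finset.sum_boole, Finset.filter_filter]
    congr 2
    ext σ
    simp only [Finset.mem_filter, Finset.mem_univ, true_and]
    tauto
  have hmod := ZMod.natCast_eq_natCast_iff
    (θ.filter fun σ => ρ ⊆ σ ∧ σ.card = ρ.card + 1).card 1 2
  rw [Nat.cast_one] at hmod
  rw [h, hmod]
  simp [chainBd, Nat.ModEq]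

/-- Acyclicity of the augmented chain complex implies vanishing of reduced homology. -/
theorem hVanish_of_exists_bd_eq {V : Type} [DecidableEq V] [Fintype V]
    {K : Finset (Finset V)}
    (h : ∀ z ∈ chainsOn {σ | σ = ∅ ∨ σ ∈ K}, SimpChain.bd z = 0 →
      ∃ w ∈ chainsOn {σ | σ = ∅ ∨ σ ∈ K}, SimpChain.bd w = z) (i : ℕ) : HVanish K i := by
  intro θ hθ hbd
  have h01 : ∀ a : ZMod 2, a ≠ 1 → a = 0 := by decide
  obtain ⟨w, hw, hwbd⟩ := h (chainOf θ)
    (by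
      rw [mem_supported]
      intro σ hσ
      have : σ ∈ θ := by
        by_contra hn
        simp [chainOf, hn] at hσ
      exact Or.inr (hθ σ this).1)
    (by
      ext ρ
      refine h01 _ fun hρ => ?_
      have := mem_chainBd.2 hρ
      simp [hbd] at this)
  refine ⟨Finset.univ.filter fun σ => σ.card = i + 2 ∧ w σ = 1, fun σ hσ => ?_, ?_⟩
  · simp only [Finset.mem_filter, Finset.mem_univ, true_and] at hσ
    have hsup : σ ∈ w.support := by simp [hσ.2]
    rcases (mem_supported _ _).1 hw hsup with rfl | hK
    · simp at hσ
    · exact ⟨hK, hσ.1⟩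
  · ext ρ
    by_cases hc : ρ.card = i + 1
    · have hw' : SimpChain.bd w ρ = if ρ ∈ θ then 1 else 0 := by simp [hwbd, chainOf]
      rw [mem_chainBd]
      have : SimpChain.bd (chainOf (Finset.univ.filter fun σ => σ.card = i + 2 ∧ w σ = 1)) ρ =
          SimpChain.bd w ρ := by
        rw [SimpChain.bd_apply, SimpChain.bd_apply]
        refine Finset.sum_congr rfl fun σ hσ => ?_
        have hcard : σ.card = i + 2 := by
          have := (Finset.mem_filter.1 hσ).2.2
          omega
        by_cases h1 : w σ = 1
        · simp [chainOf, hcard, h1]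
        · simp [chainOf, h01 _ h1]
      rw [this, hw']
      simp
    · have h1 : ρ ∉ θ := fun hρ => hc (hθ ρ hρ).2
      simp only [h1, iff_false]
      simp only [chainBd, Finset.mem_filter, Finset.mem_univ, true_and]
      rw [Finset.card_eq_zero.2 (Finset.filter_eq_empty_iff.2 fun σ hσ => ?_)]
      · simp
      · have h2 := (Finset.mem_filter.1 hσ).2.1
        omega

/-- A nonempty acyclic complex has a connected realization. -/
theorem isConnected_realization {V : Type*} [Fintype V] [DecidableEq V] {L : Set (Finset V)}
    (hL : ∀ σ ∈ L, ∀ τ ⊆ σ, τ ∈ L) {a : V} (ha : {a} ∈ L)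
    (h : ∀ z ∈ chainsOn L, SimpChain.bd z = 0 → ∃ w ∈ chainsOn L, SimpChain.bd w = z) :
    IsConnected (realization L) := by
  set e : V → V → ℝ := fun p => Pi.single p 1 with he
  set C := connectedComponentIn (realization L) (e a) with hC
  have hcell : ∀ σ ∈ L, ∀ x ∈ realization {τ | τ ⊆ σ}, ∀ y ∈ realization {τ | τ ⊆ σ},
      x ∈ C → y ∈ C := by
    intro σ hσ x hx y hy hxC
    rw [hC, connectedComponentIn_eq hxC]
    exact (convex_realization_subset σ).isPreconnected.subset_connectedComponentIn hx
      (realization_mono fun τ hτ => hL σ hσ τ hτ) hy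
  have hvert : ∀ σ ∈ L, ∀ p ∈ σ, e p ∈ realization {τ | τ ⊆ σ} := fun σ _ p hp =>
    single_mem_realization (Finset.singleton_subset_iff.2 hp)
  have haC : e a ∈ C := mem_connectedComponentIn (single_mem_realization ha)
  classical
  let count : SimpChain V →ₗ[ZMod 2] ZMod 2 :=
    linearCombination (ZMod 2) fun σ => if ∃ p, σ = {p} ∧ e p ∈ C then 1 else 0
  have hcount1 : ∀ p, count (single {p} 1) = if e p ∈ C then 1 else 0 := by
    intro p
    simp [count]
  have hcount : ∀ z ∈ chainsOn L, count (SimpChain.bd z) = 0 := by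
    intro z hz
    refine eq_of_single (count ∘ₗ SimpChain.bd) 0 hz fun σ hσ => ?_
    rw [LinearMap.comp_apply, SimpChain.bd_single, map_sum, LinearMap.zero_apply]
    by_cases hc : σ.card = 2
    · obtain ⟨p, q, hpq, rfl⟩ := Finset.card_eq_two.1 hc
      have hiff : e p ∈ C ↔ e q ∈ C :=
        ⟨hcell _ hσ _ (hvert _ hσ p (by simp)) _ (hvert _ hσ q (by simp)),
          hcell _ hσ _ (hvert _ hσ q (by simp)) _ (hvert _ hσ p (by simp))⟩
      have h1 : ({p, q} : Finset V).erase p = {q} := by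
        rw [Finset.erase_insert]; simpa using hpq
      have h2 : ({p, q} : Finset V).erase q = {p} := by
        rw [Finset.pair_comm, Finset.erase_insert]; simpa using hpq.symm
      rw [Finset.sum_pair hpq, h1, h2, hcount1, hcount1, if_congr hiff rfl rfl,
        ZModModule.add_self]
    · refine Finset.sum_eq_zero fun p hp => ?_
      simp only [count, linearCombination_single, one_smul]
      refine if_neg ?_
      rintro ⟨q, hq, -⟩
      have := Finset.card_erase_add_one hp
      rw [hq, Finset.card_singleton] at this
      omega
  have hall : ∀ b, {b} ∈ L → e b ∈ C := by
    intro b hb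
    obtain ⟨w, hw, hwbd⟩ := h (single {a} 1 + single {b} 1)
      (Submodule.add_mem _ (single_mem_chainsOn ha 1) (single_mem_chainsOn hb 1))
      (by simp [SimpChain.bd_single, ZModModule.add_self])
    have h1 := hcount w hw
    rw [hwbd, map_add, hcount1, hcount1, if_pos haC] at h1
    by_contra hn
    simp [hn] at h1
  have hsub : realization L ⊆ C := by
    intro x hx
    have hne : (coordSupport x).Nonempty := by
      rw [Finset.nonempty_iff_ne_empty]
      intro h0
      have hz : ∀ p, x p = 0 := fun p => by
        by_contra hp
        have := mem_coordSupport.2 hp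
        simp [h0] at this
      have := hx.2.1
      simp [hz] at this
    obtain ⟨p, hp⟩ := hne
    have hpL : {p} ∈ L := hL _ hx.2.2 _ (Finset.singleton_subset_iff.2 hp)
    exact hcell _ hx.2.2 _ (hvert _ hx.2.2 p hp) x ⟨hx.1, hx.2.1, Finset.Subset.refl _⟩ (hall p hpL)
  refine ⟨⟨_, single_mem_realization ha⟩, ?_⟩
  rw [hsub.antisymm (connectedComponentIn_subset _ _)]
  exact isPreconnected_connectedComponentIn

/-- **Tietze extension theorem** for functions that are continuous on a closed set and take values
in a finite-dimensional space. -/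
theorem ContinuousOn.exists_continuous_eqOn {X Y : Type*} [TopologicalSpace X] [NormalSpace X]
    [NormedAddCommGroup Y] [NormedSpace ℝ Y] [FiniteDimensional ℝ Y] {s : Set X} {f : X → Y}
    (hf : ContinuousOn f s) (hs : IsClosed s) : ∃ g, Continuous g ∧ Set.EqOn g f s := by
  have := RCLike.instTietzeExtensionTVS (𝕜 := ℝ) (E := Y)
  obtain ⟨g, hg⟩ := ContinuousMap.exists_restrict_eq hs ⟨s.domRestrict f, hf.domRestrict⟩
  exact ⟨g, g.continuous, fun x hx => congrArg (fun φ : C(s, Y) => φ ⟨x, hx⟩) hg⟩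

/-- If a subset `F` of a normed space is homeomorphic to a subset `R` of a normed space `E` that
is closed under scaling by factors at least one and omits the origin, with homeomorphisms
that extend to the whole spaces, then the complement of `F` in `N × E` is contractible. -/
theorem exists_contraction_compl {N E : Type*} [NormedAddCommGroup N] [NormedSpace ℝ N]
    [NormedAddCommGroup E] [NormedSpace ℝ E] {F : Set N} {R : Set E} {ψ : N → E} {χ : E → N}
    (hψ : Continuous ψ) (hχ : Continuous χ) (hψF : Set.MapsTo ψ F R) (hχR : Set.MapsTo χ R F)
    (hχψ : Set.LeftInvOn χ ψ F) (hψχ : Set.LeftInvOn ψ χ R)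
    (hR : ∀ u ∈ R, ∀ t : ℝ, 1 ≤ t → t • u ∈ R) (h0 : (0 : E) ∉ R) :
    ∃ H : (N × E) × ℝ → N × E, Continuous H ∧ (∀ p, H (p, 0) = p) ∧
      (∃ q ∉ F ×ˢ {0}, ∀ p, H (p, 1) = q) ∧
      ∀ p ∉ F ×ˢ {0}, ∀ t ∈ Set.Icc (0 : ℝ) 1, H (p, t) ∉ F ×ˢ {0} := by
  let Θ : N × E → N × E := fun p => (p.1 - χ (p.2 + ψ p.1), p.2 + ψ p.1)
  let Θ' : N × E → N × E := fun p => (p.1 + χ p.2, p.2 - ψ (p.1 + χ p.2))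
  have hΘΘ' : ∀ p, Θ (Θ' p) = p := fun p => by simp [Θ, Θ']
  have hΘ'Θ : ∀ p, Θ' (Θ p) = p := fun p => by simp [Θ, Θ']
  have hΘ : ∀ p, p ∈ F ×ˢ ({0} : Set E) ↔ Θ p ∈ ({0} : Set N) ×ˢ R := by
    rintro ⟨y, u⟩
    constructor
    · rintro ⟨hy, hu⟩
      obtain rfl : u = 0 := hu
      change y ∈ F at hy
      simpa [Θ, hχψ hy] using hψF hy
    · intro h
      have h1 : Θ (y, u) = (0, (Θ (y, u)).2) := Prod.ext h.1 rfl
      rw [← hΘ'Θ (y, u), h1]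
      have h2 : (Θ (y, u)).2 ∈ R := h.2
      simpa [Θ', hψχ h2] using hχR h2
  have hΘ0 : Θ' 0 ∉ F ×ˢ {0} := fun h => by
    have := (hΘ _).1 h
    rw [hΘΘ'] at this
    exact h0 this.2
  refine ⟨fun x => Θ' ((1 - x.2) • Θ x.1), by fun_prop, fun p => by simp [hΘ'Θ],
    ⟨Θ' 0, hΘ0, fun p => by simp⟩, fun p hp t ht hmem => ?_⟩
  dsimp only at hmem
  rcases ht.2.eq_or_lt with rfl | ht1
  · exact hΘ0 (by simpa using hmem)
  rw [hΘ, hΘΘ'] at hmem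
  refine hp ((hΘ p).2 ?_)
  have hpos : 0 < 1 - t := sub_pos.2 ht1
  refine ⟨(smul_eq_zero.1 hmem.1).resolve_left hpos.ne', ?_⟩
  have := hR _ hmem.2 (1 - t)⁻¹ ((one_le_inv₀ hpos).2 (by linarith [ht.1]))
  simpa [smul_smul, inv_mul_cancel₀ hpos.ne'] using this

/-- Unnormalized coordinates of a point in the join of the realization of a complex on `V`,
restricted to the complement of `W`, with the boundary of the simplex on `Option V`, whose cone is
identified with `V → ℝ`. -/
noncomputable def joinWeights {V : Type*} [Fintype V] [DecidableEq V] (W : Finset V)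
    (q : (V → ℝ) × (V → ℝ)) : V ⊕ Option V → ℝ :=
  Sum.elim (fun w => if w ∈ W then 0 else q.1 w) fun o =>
    o.elim 0 q.2 - Finset.univ.inf' Finset.univ_nonempty fun o' : Option V => o'.elim 0 q.2

section joinWeights

variable {V : Type*} [Fintype V] [DecidableEq V] {W : Finset V} {x u : V → ℝ}

theorem continuous_joinWeights : Continuous (joinWeights W) := by
  have h : ∀ o : Option V, Continuous fun q : (V → ℝ) × (V → ℝ) => o.elim 0 q.2 := by
    rintro (_ | w)
    · exact continuous_const
    · exact (continuous_apply w).comp continuous_snd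
  refine continuous_pi ?_
  rintro (w | o)
  · by_cases hw : w ∈ W
    · simpa [joinWeights, hw] using continuous_const
    · simpa [joinWeights, hw, Function.comp_def] using
        (continuous_apply w).comp (continuous_fst (X := V → ℝ) (Y := V → ℝ))
  · exact (h o).sub (Continuous.finset_inf'_apply _ fun o' _ => h o')

theorem joinWeights_nonneg (hx : ∀ v, 0 ≤ x v) (p : V ⊕ Option V) :
    0 ≤ joinWeights W (x, u) p := by
  rcases p with w | o
  · simp only [joinWeights, Sum.elim_inl]
    split_ifs
    exacts [le_rfl, hx w]
  · exact sub_nonneg.2 (Finset.inf'_le _ (Finset.mem_univ o))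

theorem coordSupport_joinWeights_toLeft :
    (coordSupport (joinWeights W (x, u))).toLeft = coordSupport x \ W := by
  ext w
  by_cases hw : w ∈ W <;> simp [joinWeights, hw]

theorem coordSupport_joinWeights_toRight_ne_univ :
    (coordSupport (joinWeights W (x, u))).toRight ≠ Finset.univ := by
  obtain ⟨o, -, ho⟩ := Finset.exists_mem_eq_inf' Finset.univ_nonempty
    fun o : Option V => o.elim 0 u
  intro h
  have := h ▸ Finset.mem_univ o
  simp [joinWeights, ho] at this

theorem sum_joinWeights_pos (hx : ∀ v, 0 ≤ x v) (h : coordSupport x ⊆ W → u ≠ 0) :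
    0 < ∑ p, joinWeights W (x, u) p := by
  have hnn := fun p => joinWeights_nonneg (W := W) (u := u) hx p
  refine (Finset.sum_nonneg fun p _ => hnn p).lt_of_ne fun h0 => ?_
  have hz := fun p => (Finset.sum_eq_zero_iff_of_nonneg fun p _ => hnn p).1 h0.symm p
    (Finset.mem_univ p)
  refine h (fun w hw => ?_) (funext fun w => ?_)
  · by_contra hW
    exact mem_coordSupport.1 hw (by simpa [joinWeights, hW] using hz (Sum.inl w))
  · have h1 := hz (Sum.inr none)
    have h2 := hz (Sum.inr (some w))
    simp only [joinWeights, Sum.elim_inr, Option.elim_none, Option.elim_some] at h1 h2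
    simp only [Pi.zero_apply]
    linarith

/-- The point of the join with coordinates proportional to `joinWeights`. -/
noncomputable def joinPoint (W : Finset V) (q : (V → ℝ) × (V → ℝ)) : V ⊕ Option V → ℝ :=
  (∑ p, joinWeights W q p)⁻¹ • joinWeights W q

theorem continuousOn_joinPoint :
    ContinuousOn (joinPoint W) {q | (∀ v, 0 ≤ q.1 v) ∧ (coordSupport q.1 ⊆ W → q.2 ≠ 0)} := by
  have h : Continuous fun q => ∑ p, joinWeights W q p :=
    continuous_finsetSum _ fun p _ => (continuous_apply p).comp continuous_joinWeights
  exact (h.continuousOn.inv₀ fun q hq => (sum_joinWeights_pos hq.1 hq.2).ne').smul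
    continuous_joinWeights.continuousOn

theorem coordSupport_joinPoint (hx : ∀ v, 0 ≤ x v) (h : coordSupport x ⊆ W → u ≠ 0) :
    coordSupport (joinPoint W (x, u)) = coordSupport (joinWeights W (x, u)) := by
  ext p
  rw [mem_coordSupport, mem_coordSupport, joinPoint, Pi.smul_apply, smul_ne_zero_iff]
  exact and_iff_right (inv_ne_zero (sum_joinWeights_pos hx h).ne')

theorem joinPoint_mem_realization {L : Set (Finset V)} (hL : ∀ σ ∈ L, ∀ τ ⊆ σ, τ ∈ L)
    (hx : x ∈ realization L) (h : coordSupport x ⊆ W → u ≠ 0) :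
    joinPoint W (x, u) ∈
      realization (SimpChain.joinBoundary (Option V) {σ | σ ∈ L ∧ Disjoint σ W}) := by
  have hpos := sum_joinWeights_pos hx.1 h
  refine ⟨fun p => mul_nonneg (inv_nonneg.2 hpos.le) (joinWeights_nonneg hx.1 p), ?_, ?_⟩
  · simp only [joinPoint, Pi.smul_apply, smul_eq_mul, ← Finset.mul_sum]
    exact inv_mul_cancel₀ hpos.ne'
  · rw [coordSupport_joinPoint hx.1 h]
    refine ⟨?_, coordSupport_joinWeights_toRight_ne_univ⟩
    rw [coordSupport_joinWeights_toLeft]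
    exact ⟨hL _ hx.2.2 _ Finset.sdiff_subset, Finset.sdiff_disjoint⟩

/-- The weights recover a point whose coordinates are not all positive on the second factor. -/
theorem joinWeights_inr {p : V ⊕ Option V → ℝ} (hp : ∀ a, 0 ≤ p a)
    (hr : (coordSupport p).toRight ≠ Finset.univ) (o : Option V) :
    joinWeights W (x, fun w => p (Sum.inr (some w)) - p (Sum.inr none)) (Sum.inr o) =
      p (Sum.inr o) := by
  have h : ∀ o : Option V, o.elim 0 (fun w => p (Sum.inr (some w)) - p (Sum.inr none)) =
      p (Sum.inr o) - p (Sum.inr none) := by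
    rintro (_ | w) <;> simp
  obtain ⟨o₀, ho₀⟩ : ∃ o₀ : Option V, p (Sum.inr o₀) = 0 := by
    by_contra! hall
    exact hr (Finset.eq_univ_iff_forall.2 fun o => by simpa using hall o)
  have hinf : (Finset.univ.inf' Finset.univ_nonempty fun o' : Option V =>
      o'.elim 0 fun w => p (Sum.inr (some w)) - p (Sum.inr none)) = -p (Sum.inr none) := by
    refine le_antisymm ((Finset.inf'_le _ (Finset.mem_univ o₀)).trans ?_)
      (Finset.le_inf' _ _ fun o _ => ?_)
    · rw [h, ho₀, zero_sub]
    · rw [h]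
      linarith [hp (Sum.inr o)]
  rw [joinWeights, Sum.elim_inr, hinf, h, sub_neg_eq_add, sub_add_cancel]

end joinWeights

/-- Suppose that `N` maps to the realization of a complex `L`, with a partial inverse on
the part of the realization carried by simplices disjoint from `W`, and that the complement in
`N × (V → ℝ)` of the preimage of the part carried by subsets of `W` is contractible. Then the
complex of simplices of `L` disjoint from `W` is acyclic. -/
theorem exists_bd_eq_of_contraction_compl {V N : Type*} [Fintype V] [DecidableEq V]
    [NormedAddCommGroup N] [NormedSpace ℝ N] [FiniteDimensional ℝ N] {L : Set (Finset V)}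
    (hL : ∀ σ ∈ L, ∀ τ ⊆ σ, τ ∈ L) {W : Finset V} {k : N → V → ℝ} (hk : Continuous k)
    (hkL : ∀ y, k y ∈ realization L) {h : (V → ℝ) → N}
    (hh : ContinuousOn h (realization {σ | σ ∈ L ∧ Disjoint σ W}))
    (hkh : ∀ x ∈ realization {σ | σ ∈ L ∧ Disjoint σ W}, k (h x) = x)
    {H : (N × (V → ℝ)) × ℝ → N × (V → ℝ)} (hH : Continuous H) (hH0 : ∀ p, H (p, 0) = p)
    (hH1 : ∃ q ∉ {y | coordSupport (k y) ⊆ W} ×ˢ {0}, ∀ p, H (p, 1) = q)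
    (hHF : ∀ p ∉ {y | coordSupport (k y) ⊆ W} ×ˢ {0}, ∀ t ∈ Set.Icc (0 : ℝ) 1,
      H (p, t) ∉ {y | coordSupport (k y) ⊆ W} ×ˢ {0})
    {z : SimpChain V} (hz : z ∈ chainsOn {σ | σ ∈ L ∧ Disjoint σ W})
    (hbd : SimpChain.bd z = 0) :
    ∃ w ∈ chainsOn {σ | σ ∈ L ∧ Disjoint σ W}, SimpChain.bd w = z := by
  set K : Set (Finset V) := {σ | σ ∈ L ∧ Disjoint σ W} with hK
  have hKdown : ∀ σ ∈ K, ∀ τ ⊆ σ, τ ∈ K := fun σ hσ τ hτ =>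
    ⟨hL σ hσ.1 τ hτ, hσ.2.mono_left hτ⟩
  set J := SimpChain.joinBoundary (Option V) K with hJ
  have hJdown : ∀ σ ∈ J, ∀ τ ⊆ σ, τ ∈ J := fun σ hσ τ hτ =>
    ⟨hKdown _ hσ.1 _ (Finset.toLeft_subset_toLeft hτ), fun hu => hσ.2
      (Finset.univ_subset_iff.1 (hu ▸ Finset.toRight_subset_toRight hτ))⟩
  set Ω : Set (N × (V → ℝ)) := {p | p ∉ {y | coordSupport (k y) ⊆ W} ×ˢ {0}} with hΩ
  have hΩ_ne : ∀ p ∈ Ω, coordSupport (k p.1) ⊆ W → p.2 ≠ 0 := fun p hp h1 h2 => hp ⟨h1, h2⟩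
  -- the map from `Ω` to the join
  let g : N × (V → ℝ) → V ⊕ Option V → ℝ := fun p => joinPoint W (k p.1, p.2)
  have hg : ContinuousOn g Ω := by
    refine continuousOn_joinPoint.comp (Continuous.continuousOn (by fun_prop)) fun p hp => ?_
    exact ⟨(hkL p.1).1, hΩ_ne p hp⟩
  have hgJ : Set.MapsTo g Ω (realization J) := fun p hp =>
    joinPoint_mem_realization hL (hkL p.1) (hΩ_ne p hp)
  -- the map from the join to `Ω`
  let D : Set (V ⊕ Option V → ℝ) := {p ∈ realization J | ∀ o, p (Sum.inr o) = 0}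
  have hDK : ∀ p ∈ D, (fun v => p (Sum.inl v)) ∈ realization K := by
    rintro p ⟨hp, h0⟩
    refine ⟨fun v => hp.1 _, ?_, ?_⟩
    · have := hp.2.1
      rwa [Fintype.sum_sum_type, Finset.sum_eq_zero fun o _ => h0 o, add_zero] at this
    · convert hp.2.2.1
      ext v
      simp
  have hDclosed : IsClosed D := by
    refine (isCompact_realization hJdown).isClosed.inter ?_
    change IsClosed {p : V ⊕ Option V → ℝ | ∀ o, p (Sum.inr o) = 0}
    rw [Set.ofPred_forall]
    exact isClosed_iInter fun o => isClosed_eq (continuous_apply _) continuous_const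
  obtain ⟨f₁, hf₁, hf₁D⟩ := ContinuousOn.exists_continuous_eqOn
    (f := fun p : V ⊕ Option V → ℝ => h fun v => p (Sum.inl v))
    (hh.comp (Continuous.continuousOn (by fun_prop)) hDK) hDclosed
  let f : (V ⊕ Option V → ℝ) → N × (V → ℝ) := fun p =>
    (f₁ p, fun w => p (Sum.inr (some w)) - p (Sum.inr none))
  have hf : Continuous f := by fun_prop
  have hf0 : ∀ p ∈ realization J, (f p).2 = 0 → p ∈ D := by
    intro p hp h0
    refine ⟨hp, ?_⟩
    have h1 : ∀ o, p (Sum.inr o) = p (Sum.inr none) := by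
      rintro (_ | w)
      · rfl
      · exact sub_eq_zero.1 (congrFun h0 w)
    intro o
    by_contra hne
    refine hp.2.2.2 (Finset.eq_univ_iff_forall.2 fun o' => ?_)
    rw [Finset.mem_toRight, mem_coordSupport, h1 o', ← h1 o]
    exact hne
  have hfD : ∀ p ∈ D, k (f p).1 = fun v => p (Sum.inl v) := by
    intro p hp
    simp only [f, hf₁D hp]
    exact hkh _ (hDK p hp)
  have hfΩ : Set.MapsTo f (realization J) Ω := by
    rintro p hp ⟨h1, h2⟩
    have hpD := hf0 p hp h2
    change coordSupport (k (f p).1) ⊆ W at h1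
    rw [hfD p hpD] at h1
    have hx := hDK p hpD
    have hemp : coordSupport (fun v => p (Sum.inl v)) = ∅ := by
      rw [← Finset.disjoint_self_iff_empty]
      exact hx.2.2.2.mono_right h1
    have hsum := hx.2.1
    rw [Finset.sum_eq_zero fun v _ => by
      by_contra hv
      have := mem_coordSupport (x := fun v => p (Sum.inl v)).2 hv
      simp [hemp] at this] at hsum
    exact zero_ne_one hsum
  have hgf_right : ∀ p ∈ realization J,
      (coordSupport (g (f p))).toRight = (coordSupport p).toRight := by
    intro p hp
    rw [coordSupport_joinPoint (hkL _).1 (hΩ_ne _ (hfΩ hp))]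
    ext o
    simp only [Finset.mem_toRight, mem_coordSupport, f]
    rw [joinWeights_inr hp.1 hp.2.2.2]
  have hgf_left : ∀ p ∈ D, (coordSupport (g (f p))).toLeft = (coordSupport p).toLeft := by
    intro p hp
    rw [coordSupport_joinPoint (hkL _).1 (hΩ_ne _ (hfΩ hp.1)), coordSupport_joinWeights_toLeft,
      hfD p hp, Finset.sdiff_eq_self_of_disjoint (hDK p hp).2.2.2]
    ext v
    simp
  -- the carrier of the composite self-map of the join
  let Φ : Finset (V ⊕ Option V) → Set (Finset (V ⊕ Option V)) := fun σ =>
    {τ | τ ∈ J ∧ τ.toRight ⊆ σ.toRight ∧ (σ.toRight = ∅ → τ ⊆ σ)}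
  refine SimpChain.exists_bd_eq_of_joinBoundary (T := Option V) (fun ζ hζ hζbd => ?_) hz hbd
  obtain ⟨q, hqΩ, hq⟩ := hH1
  refine exists_bd_eq_of_contraction hJdown Φ (fun σ τ hτ => hτ.1) ?_ ?_ ?_ ?_
    (G := fun x => g (H (f x.1, x.2))) (hg.comp (Continuous.continuousOn (by fun_prop)) ?_)
    (hgJ.comp ?_) ?_ (hgJ hqΩ) (fun x _ => by simp only [hq]) hζ hζbd
  · intro σ τ hτσ ρ hρ
    have hr := Finset.toRight_subset_toRight hτσ
    exact ⟨hρ.1, hρ.2.1.trans hr, fun h0 =>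
      (hρ.2.2 (Finset.subset_empty.1 (h0 ▸ hr))).trans hτσ⟩
  · exact fun σ hσ => ⟨hσ, Finset.Subset.refl _, fun _ => Finset.Subset.refl _⟩
  · exact fun σ τ hτ τ' hτ' => ⟨hJdown _ hτ.1 _ hτ',
      (Finset.toRight_subset_toRight hτ').trans hτ.2.1,
      fun h => hτ'.trans (hτ.2.2 h)⟩
  · intro σ hσ hne
    rcases σ.toRight.eq_empty_or_nonempty with h0 | ⟨o, ho⟩
    · obtain ⟨p, hp⟩ := hne
      refine ⟨p, fun τ hτ => ?_⟩
      have hsub : insert p τ ⊆ σ := Finset.insert_subset hp (hτ.2.2 h0)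
      exact ⟨hJdown σ hσ _ hsub, Finset.toRight_subset_toRight hsub, fun _ => hsub⟩
    · refine ⟨Sum.inr o, fun τ hτ => ?_⟩
      have hsub : (insert (Sum.inr o) τ).toRight ⊆ σ.toRight := by
        rw [Finset.toRight_insert_inr]
        exact Finset.insert_subset ho hτ.2.1
      refine ⟨⟨?_, fun hu => hσ.2 (Finset.univ_subset_iff.1 (hu ▸ hsub))⟩, hsub, fun h0 => ?_⟩
      · rw [Finset.toLeft_insert_inr]
        exact hτ.1.1
      · simp [h0] at ho
  · exact fun x hx => hHF _ (hfΩ hx.1) _ hx.2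
  · exact fun x hx => hHF _ (hfΩ hx.1) _ hx.2
  · intro x hx
    simp only [hH0]
    refine ⟨(hgJ (hfΩ hx)).2.2, (hgf_right x hx).subset, fun h0 => ?_⟩
    have hxD : x ∈ D := ⟨hx, fun o => by
      by_contra hne
      have : o ∈ (coordSupport x).toRight := by simpa using hne
      simp [h0] at this⟩
    have : coordSupport (g (f x)) = coordSupport x := by
      rw [← Finset.toLeft_disjSum_toRight (u := coordSupport (g (f x))), hgf_left x hxD,
        hgf_right x hx, Finset.toLeft_disjSum_toRight]
    exact this.subset

/-- The complement of a point in a topological sphere is parametrized by Euclidean space. -/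
theorem exists_chart_of_homeomorph_sphere {E : Type*} [TopologicalSpace E] {X : Set E} {n : ℕ}
    (e : X ≃ₜ Metric.sphere (0 : EuclideanSpace ℝ (Fin (n + 1))) 1) {a : E} (ha : a ∈ X) :
    ∃ (k : EuclideanSpace ℝ (Fin n) → E) (h : E → EuclideanSpace ℝ (Fin n)), Continuous k ∧
      (∀ y, k y ∈ X \ {a}) ∧ ContinuousOn h (X \ {a}) ∧ (∀ x ∈ X \ {a}, k (h x) = x) ∧
      ∀ y, h (k y) = y := by
  classical
  have : Fact (Module.finrank ℝ (EuclideanSpace ℝ (Fin (n + 1))) = n + 1) :=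
    ⟨finrank_euclideanSpace_fin⟩
  let φ := stereographic' n (e ⟨a, ha⟩)
  have hsource : ∀ x : X, (x : E) ≠ a → e x ∈ φ.source := fun x hx => by
    simpa [φ, Subtype.ext_iff] using hx
  have htarget : ∀ y, y ∈ φ.target := fun y => by simp [φ]
  refine ⟨fun y => e.symm (φ.symm y), fun x => if hx : x ∈ X then φ (e ⟨x, hx⟩) else 0,
    ?_, fun y => ⟨Subtype.coe_prop _, fun h => ?_⟩, ?_, ?_, fun y => ?_⟩
  · have : Continuous φ.symm := by
      rw [← continuousOn_univ]
      exact φ.continuousOn_symm.mono fun y _ => htarget y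
    fun_prop
  · have h1 : e.symm (φ.symm y) = ⟨a, ha⟩ := Subtype.ext h
    have h2 := φ.map_target (htarget y)
    rw [e.symm_apply_eq] at h1
    rw [h1] at h2
    simp [φ] at h2
  · rw [continuousOn_iff_continuous_domRestrict]
    have h1 : Continuous fun x : ↥(X \ {a}) => φ (e ⟨x, x.2.1⟩) :=
      φ.continuousOn.comp_continuous (by fun_prop) fun x => hsource _ x.2.2
    convert h1 using 2 with x
    simp [x.2.1]
  · rintro x ⟨hx, hxa⟩
    simp only [hx, dif_pos]
    rw [φ.left_inv (hsource ⟨x, hx⟩ hxa), e.symm_apply_apply]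
  · simp [φ.right_inv (htarget y)]

/-- Unbounded radial model of the star-shaped complement of the apex in a cone. -/
def coneRays {V : Type*} [Fintype V] (L : Set (Finset V)) (W : Finset V) (v : V) : Set (V → ℝ) :=
  {u | (∀ w, 0 ≤ u w) ∧ u v = 0 ∧ 1 ≤ ∑ w, u w ∧ coordSupport u ⊆ W ∧ coordSupport u ∈ L}

section coneRays

variable {V : Type*} [Fintype V] {L : Set (Finset V)} {W : Finset V} {v : V}

theorem isClosed_coneRays (hL : ∀ σ ∈ L, ∀ τ ⊆ σ, τ ∈ L) : IsClosed (coneRays L W v) := by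
  have heq : coneRays L W v = Set.Ici 0 ∩ {u | u v = 0} ∩ {u | 1 ≤ ∑ w, u w} ∩
      ⋃ σ ∈ {σ | σ ⊆ W ∧ σ ∈ L}, {u | ∀ w ∉ σ, u w = 0} := by
    ext u
    simp only [coneRays, Set.mem_inter_iff, Set.mem_Ici, Set.mem_iUnion, Set.mem_ofPred_eq,
      exists_prop, Pi.le_def, Pi.zero_apply]
    constructor
    · rintro ⟨h1, h2, h3, h4⟩
      exact ⟨⟨⟨h1, h2⟩, h3⟩, _, h4, fun w hw => by simpa using hw⟩
    · rintro ⟨⟨⟨h1, h2⟩, h3⟩, σ, ⟨h4, h5⟩, h6⟩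
      have hsub : coordSupport u ⊆ σ := fun w hw => by
        by_contra hn
        exact mem_coordSupport.1 hw (h6 w hn)
      exact ⟨h1, h2, h3, hsub.trans h4, hL σ h5 _ hsub⟩
  rw [heq]
  refine ((isClosed_Ici.inter (isClosed_eq (by fun_prop) continuous_const)).inter
    (isClosed_le continuous_const (by fun_prop))).inter
    ((Set.toFinite _).isClosed_biUnion fun σ _ => ?_)
  simp only [Set.ofPred_forall]
  exact isClosed_iInter fun w => isClosed_iInter fun _ =>
    isClosed_eq (continuous_apply w) continuous_const

theorem smul_mem_coneRays {u : V → ℝ} (hu : u ∈ coneRays L W v) {t : ℝ} (ht : 1 ≤ t) :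
    t • u ∈ coneRays L W v := by
  have ht0 : 0 < t := one_pos.trans_le ht
  have hsupp : coordSupport (t • u) = coordSupport u := by
    ext w
    simp [ht0.ne']
  obtain ⟨h1, h2, h3, h4, h5⟩ := hu
  refine ⟨fun w => mul_nonneg ht0.le (h1 w), by simp [h2], ?_, hsupp ▸ h4, hsupp ▸ h5⟩
  simp only [Pi.smul_apply, smul_eq_mul, ← Finset.mul_sum]
  exact one_le_mul_of_one_le_of_one_le ht h3

theorem zero_notMem_coneRays : (0 : V → ℝ) ∉ coneRays L W v := fun h => by
  have := h.2.2.1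
  norm_num at this

variable [DecidableEq V] {x : V → ℝ}

theorem eq_single_of_mem_realization (hx : x ∈ realization L) (h : x v = 1) :
    x = Pi.single v 1 := by
  have hsum : ∑ w ∈ Finset.univ.erase v, x w = 0 := by
    have := hx.2.1
    rw [← Finset.add_sum_erase _ _ (Finset.mem_univ v), h] at this
    linarith
  have hz := (Finset.sum_eq_zero_iff_of_nonneg fun w _ => hx.1 w).1 hsum
  ext w
  by_cases hw : w = v
  · subst hw
    simpa using h
  · simpa [hw] using hz w (by simp [hw])

theorem coord_lt_one_of_mem_realization (hx : x ∈ realization L \ {Pi.single v 1}) : x v < 1 := by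
  refine lt_of_le_of_ne ?_ fun h => hx.2 (eq_single_of_mem_realization hx.1 h)
  rw [← hx.1.2.1]
  exact Finset.single_le_sum (fun w _ => hx.1.1 w) (Finset.mem_univ v)

theorem sum_update_zero (hx : x ∈ realization L) : ∑ w, Function.update x v 0 w = 1 - x v := by
  rw [Finset.sum_update_of_mem (Finset.mem_univ v), zero_add, ← hx.2.1,
    Finset.sdiff_singleton_eq_erase, ← Finset.add_sum_erase _ _ (Finset.mem_univ v)]
  ring

/-- Stretching a cone minus its apex radially to infinity. -/
noncomputable def toConeRays (v : V) (x : V → ℝ) : V → ℝ :=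
  ((1 - x v) ^ 2)⁻¹ • Function.update x v 0

/-- The inverse of `toConeRays`. -/
noncomputable def ofConeRays (v : V) (u : V → ℝ) : V → ℝ :=
  ((∑ w, u w) ^ 2)⁻¹ • u + (1 - (∑ w, u w)⁻¹) • Pi.single v 1

theorem sum_toConeRays (hx : x ∈ realization L \ {Pi.single v 1}) :
    ∑ w, toConeRays v x w = (1 - x v)⁻¹ := by
  have hpos : 0 < 1 - x v := sub_pos.2 (coord_lt_one_of_mem_realization hx)
  simp only [toConeRays, Pi.smul_apply, smul_eq_mul, ← Finset.mul_sum]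
  rw [sum_update_zero hx.1]
  field_simp

theorem toConeRays_mem (hL : ∀ σ ∈ L, ∀ τ ⊆ σ, τ ∈ L)
    (hx : x ∈ realization L \ {Pi.single v 1}) (hW : coordSupport x ⊆ W) :
    toConeRays v x ∈ coneRays L W v := by
  have hpos : 0 < 1 - x v := sub_pos.2 (coord_lt_one_of_mem_realization hx)
  have hsupp : coordSupport (toConeRays v x) ⊆ coordSupport x := by
    intro w
    by_cases hw : w = v
    · subst hw
      simp [toConeRays]
    · simp [toConeRays, hw]
  refine ⟨fun w => mul_nonneg (by positivity) ?_, by simp [toConeRays], ?_, hsupp.trans hW,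
    hL _ hx.1.2.2 _ hsupp⟩
  · by_cases hw : w = v
    · subst hw
      simp
    · simpa [hw] using hx.1.1 w
  · rw [sum_toConeRays hx]
    exact (one_le_inv₀ hpos).2 (by linarith [hx.1.1 v])

theorem ofConeRays_toConeRays (hx : x ∈ realization L \ {Pi.single v 1}) :
    ofConeRays v (toConeRays v x) = x := by
  have hpos : 0 < 1 - x v := sub_pos.2 (coord_lt_one_of_mem_realization hx)
  rw [ofConeRays, sum_toConeRays hx]
  ext w
  by_cases hw : w = v
  · subst hw
    simp [toConeRays]
  · simp [toConeRays, hw, hpos.ne']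

theorem ofConeRays_apply_self {u : V → ℝ} (hu : u ∈ coneRays L W v) :
    ofConeRays v u v = 1 - (∑ w, u w)⁻¹ := by
  simp [ofConeRays, hu.2.1]

theorem toConeRays_ofConeRays {u : V → ℝ} (hu : u ∈ coneRays L W v) :
    toConeRays v (ofConeRays v u) = u := by
  have hpos : 0 < ∑ w, u w := one_pos.trans_le hu.2.2.1
  rw [toConeRays, ofConeRays_apply_self hu]
  ext w
  by_cases hw : w = v
  · subst hw
    simp [hu.2.1]
  · simp [ofConeRays, hw, hpos.ne']

theorem coordSupport_ofConeRays_subset (u : V → ℝ) :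
    coordSupport (ofConeRays v u) ⊆ insert v (coordSupport u) := by
  intro w hw
  by_cases hwv : w = v
  · exact hwv ▸ Finset.mem_insert_self _ _
  · refine Finset.mem_insert_of_mem (mem_coordSupport.2 fun h0 => mem_coordSupport.1 hw ?_)
    simp [ofConeRays, hwv, h0]

theorem ofConeRays_mem (hL : ∀ σ ∈ L, ∀ τ ⊆ σ, τ ∈ L)
    (hcone : ∀ σ ∈ L, σ ⊆ W → insert v σ ∈ L) {u : V → ℝ} (hu : u ∈ coneRays L W v) :
    ofConeRays v u ∈ realization L \ {Pi.single v 1} := by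
  have hpos : 0 < ∑ w, u w := one_pos.trans_le hu.2.2.1
  have hle : (∑ w, u w)⁻¹ ≤ 1 := inv_le_one_of_one_le₀ hu.2.2.1
  refine ⟨⟨fun w => add_nonneg (mul_nonneg (by positivity) (hu.1 w))
    (mul_nonneg (by linarith) ?_), ?_, hL _ (hcone _ hu.2.2.2.2 hu.2.2.2.1) _
      (coordSupport_ofConeRays_subset u)⟩, fun h => ?_⟩
  · exact (Pi.single_nonneg.2 zero_le_one : (0 : V → ℝ) ≤ Pi.single v 1) w
  · simp only [ofConeRays, Pi.add_apply, Pi.smul_apply, smul_eq_mul, Finset.sum_add_distrib,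
      ← Finset.mul_sum, Finset.sum_pi_single', Finset.mem_univ, if_true]
    field_simp
    ring
  · have := congrFun h v
    rw [ofConeRays_apply_self hu, Pi.single_eq_same] at this
    have := inv_pos.2 hpos
    linarith

theorem continuousOn_ofConeRays : ContinuousOn (ofConeRays v) (coneRays L W v) := by
  have hs : ∀ u ∈ coneRays L W v, ∑ w, u w ≠ 0 := fun u hu => (one_pos.trans_le hu.2.2.1).ne'
  have hc : ContinuousOn (fun u : V → ℝ => ∑ w, u w) (coneRays L W v) := by fun_prop
  exact (((hc.pow 2).inv₀ fun u hu => pow_ne_zero 2 (hs u hu)).smul continuousOn_id).add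
    ((continuousOn_const.sub (hc.inv₀ hs)).smul continuousOn_const)

end coneRays

/-- Let `L` be a complex whose realization is a sphere, and suppose that the subcomplex of simplices
contained in `W` is a cone. Then the subcomplex of simplices disjoint from `W` is acyclic. -/
theorem exists_bd_eq_of_homeomorph_sphere {V : Type*} [Fintype V] [DecidableEq V] {n : ℕ}
    {L : Set (Finset V)} (hL : ∀ σ ∈ L, ∀ τ ⊆ σ, τ ∈ L)
    (e : realization L ≃ₜ Metric.sphere (0 : EuclideanSpace ℝ (Fin (n + 1))) 1)
    {W : Finset V} {v : V} (hvW : v ∈ W) (hvL : {v} ∈ L)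
    (hcone : ∀ σ ∈ L, σ ⊆ W → insert v σ ∈ L)
    {z : SimpChain V} (hz : z ∈ chainsOn {σ | σ ∈ L ∧ Disjoint σ W})
    (hbd : SimpChain.bd z = 0) :
    ∃ w ∈ chainsOn {σ | σ ∈ L ∧ Disjoint σ W}, SimpChain.bd w = z := by
  obtain ⟨k, h, hk, hkX, hh, hkh, hhk⟩ :=
    exists_chart_of_homeomorph_sphere e (single_mem_realization hvL)
  have hψ : Continuous fun y => toConeRays v (k y) := by
    have h1 : Continuous fun y => (1 - k y v) ^ 2 := by fun_prop
    refine (h1.inv₀ fun y => ?_).smul (hk.update v continuous_const)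
    exact pow_ne_zero 2 (sub_pos.2 (coord_lt_one_of_mem_realization (hkX y))).ne'
  obtain ⟨χ, hχ, hχR⟩ := ContinuousOn.exists_continuous_eqOn
    (hh.comp continuousOn_ofConeRays fun u hu => ofConeRays_mem hL hcone hu)
    (isClosed_coneRays (W := W) (v := v) hL)
  have hkχ : ∀ u ∈ coneRays L W v, k (χ u) = ofConeRays v u := fun u hu => by
    rw [hχR hu]
    exact hkh _ (ofConeRays_mem hL hcone hu)
  obtain ⟨H, hH, hH0, hH1, hHF⟩ := exists_contraction_compl
    (F := {y | coordSupport (k y) ⊆ W}) (R := coneRays L W v) hψ hχ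
    (fun y hy => toConeRays_mem hL (hkX y) hy)
    (fun u hu => by
      change coordSupport (k (χ u)) ⊆ W
      rw [hkχ u hu]
      exact (coordSupport_ofConeRays_subset u).trans (Finset.insert_subset hvW hu.2.2.2.1))
    (fun y hy => by
      rw [hχR (toConeRays_mem hL (hkX y) hy)]
      simp only [Function.comp_apply]
      rw [ofConeRays_toConeRays (hkX y), hhk])
    (fun u hu => by
      rw [hkχ u hu, toConeRays_ofConeRays hu])
    (fun u hu t ht => smul_mem_coneRays hu ht) zero_notMem_coneRays
  have hsub : realization {σ | σ ∈ L ∧ Disjoint σ W} ⊆ realization L \ {Pi.single v 1} := by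
    refine fun x hx => ⟨realization_mono (fun σ hσ => hσ.1) hx, ?_⟩
    rintro rfl
    refine Finset.disjoint_left.1 hx.2.2.2 (mem_coordSupport.2 ?_) hvW
    simp
  exact exists_bd_eq_of_contraction_compl hL hk (fun y => (hkX y).1) (hh.mono hsub)
    (fun x hx => hkh x (hsub hx)) hH hH0 hH1 hHF hz hbd

end

theorem setOf_geomRep_eq_realization {V : Type} [Fintype V] (K : Finset (Finset V)) :
    {x : V → ℝ | (∀ v, 0 ≤ x v) ∧ (∀ v, x v ≤ 1) ∧ (∑ v, x v) = 1 ∧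
      (Finset.univ.filter fun v => x v ≠ 0) ∈ K} = realization {σ | σ = ∅ ∨ σ ∈ K} := by
  ext x
  constructor
  · rintro ⟨h0, -, h1, hK⟩
    exact ⟨h0, h1, Or.inr hK⟩
  · rintro ⟨h0, h1, hK⟩
    refine ⟨h0, fun v => ?_, h1, hK.resolve_left fun hemp => ?_⟩
    · rw [← h1]
      exact Finset.single_le_sum (fun w _ => h0 w) (Finset.mem_univ v)
    · rw [Finset.sum_eq_zero fun v _ => by
        by_contra hv
        have := mem_coordSupport.2 hv
        simp [hemp] at this] at h1
      exact zero_ne_one h1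

/-- The geometric realization as a subspace of `V → ℝ`. -/
def geomRepHomeomorph {V : Type} [Fintype V] (K : Finset (Finset V)) :
    GeomRep K ≃ₜ realization {σ | σ = ∅ ∨ σ ∈ K} :=
  Homeomorph.setCongr (setOf_geomRep_eq_realization K)

theorem IsComplex.mem_of_subset {V : Type} [DecidableEq V] {K : Finset (Finset V)}
    (hK : IsComplex K) : ∀ σ ∈ {σ | σ = ∅ ∨ σ ∈ K}, ∀ τ ⊆ σ, τ ∈ {σ | σ = ∅ ∨ σ ∈ K} := by
  intro σ hσ τ hτ
  rcases τ.eq_empty_or_nonempty with h | hne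
  · exact Or.inl h
  · rcases hσ with rfl | hσ
    · exact Or.inl (Finset.subset_empty.1 hτ)
    · exact Or.inr (hK.2 σ hσ τ hτ hne)

theorem IsComplex.singleton_mem {V : Type} [DecidableEq V] {K : Finset (Finset V)}
    (hK : IsComplex K) {a : V} (ha : a ∈ vertexSet K) : {a} ∈ K := by
  obtain ⟨σ, hσ, haσ⟩ := Finset.mem_sup.1 ha
  exact hK.2 σ hσ _ (Finset.singleton_subset_iff.2 haσ) (Finset.singleton_nonempty a)

/-- The homological part of Observation 5.1: if `S` is a triangulated `n`-sphere and `W`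
is a nonempty proper subset of its vertex set such that the induced subcomplex `S[W]` is
a nonempty cone, then `S − W` (the faces of `S` disjoint from `W`) has vanishing reduced
`ℤ/2`-homology in every degree, and it is nonempty and connected. -/
theorem cone_complement_has_vanishing_homology
    {V : Type} [DecidableEq V] [Fintype V] (n : ℕ) (hn : 1 ≤ n)
    (S : Finset (Finset V)) (hS : IsComplex S)
    (hSsphere : Nonempty
      (GeomRep S ≃ₜ Metric.sphere (0 : EuclideanSpace ℝ (Fin (n + 1))) 1))
    (W : Finset V) (hWne : W.Nonempty) (hWsub : W ⊆ vertexSet S)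
    (hWproper : W ≠ vertexSet S)
    (hSWne : (S.filter fun σ => σ ⊆ W).Nonempty)
    (hcone : ∃ v ∈ W, ∀ σ ∈ S.filter fun σ => σ ⊆ W,
      insert v σ ∈ S.filter fun σ => σ ⊆ W) :
    (∀ i : ℕ, HVanish (S.filter fun σ => Disjoint σ W) i) ∧
    (S.filter fun σ => Disjoint σ W).Nonempty ∧
    ConnectedSpace (GeomRep (S.filter fun σ => Disjoint σ W)) := by
  obtain ⟨e⟩ := hSsphere
  obtain ⟨v, hvW, hv⟩ := hcone
  obtain ⟨a, haS, haW⟩ := Finset.exists_of_ssubset (hWsub.ssubset_of_ne hWproper)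
  have hvS := hS.singleton_mem (hWsub hvW)
  have haK : {a} ∈ S.filter fun σ => Disjoint σ W :=
    Finset.mem_filter.2 ⟨hS.singleton_mem haS, Finset.disjoint_singleton_left.2 haW⟩
  have hK : IsComplex (S.filter fun σ => Disjoint σ W) := by
    refine ⟨fun σ hσ => hS.1 σ (Finset.mem_filter.1 hσ).1, fun σ hσ τ hτ hne => ?_⟩
    rw [Finset.mem_filter] at hσ ⊢
    exact ⟨hS.2 σ hσ.1 τ hτ hne, hσ.2.mono_left hτ⟩
  have heq : {σ | σ ∈ {σ | σ = ∅ ∨ σ ∈ S} ∧ Disjoint σ W} =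
      {σ | σ = ∅ ∨ σ ∈ S.filter fun σ => Disjoint σ W} := by
    ext σ
    simp only [Set.mem_ofPred_eq, Finset.mem_filter]
    constructor
    · rintro ⟨h | h, hd⟩
      exacts [Or.inl h, Or.inr ⟨h, hd⟩]
    · rintro (rfl | ⟨h, hd⟩)
      exacts [⟨Or.inl rfl, Finset.disjoint_empty_left W⟩, ⟨Or.inr h, hd⟩]
  have hacyclic := fun z hz hbd => exists_bd_eq_of_homeomorph_sphere (z := z) hS.mem_of_subset
    ((geomRepHomeomorph S).symm.trans e) hvW (Or.inr hvS)
    (by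
      rintro σ (rfl | hσ) hσW
      · exact Or.inr hvS
      · exact Or.inr (Finset.mem_filter.1 (hv σ (Finset.mem_filter.2 ⟨hσ, hσW⟩))).1) hz hbd
  rw [heq] at hacyclic
  refine ⟨hVanish_of_exists_bd_eq hacyclic, ⟨_, haK⟩, ?_⟩
  have := isConnected_iff_connectedSpace.1
    (isConnected_realization hK.mem_of_subset (Or.inr haK) hacyclic)
  exact (geomRepHomeomorph _).symm.surjective.connectedSpace (geomRepHomeomorph _).symm.continuous
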